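/- arXiv:2408.12876 — 2 statements merged into one kernel-verified Lean document; each statement's English description precedes it below -/
import Mathlib

section
/- For every M ∈ ℕ there exists a constant C_M > 0 such that for every p ∈ [1,∞], every sequence u⁰ ∈ ℓ^p(ℤ;ℂ) and every n ∈ ℕ*, ‖ a^{⋆n} ⋆ u⁰ − Σ_{k=1}^{K} Σ_{m=0}^{M} v^{n,k,m} ⋆ u⁰ ‖_{ℓ^p} ≤ C_M ‖u⁰‖_{ℓ^p} n^{−(M+1)/(2μ)}, where μ := max_{1≤k≤K} μ_k and v^{n,k,m} is the sequence defined by v^{n,k,m}_ℓ := κ_k^{−ℓ} F_a(κ_k)^n n^{−(m+1)/(2μ_k)} (P_{k,m}(−d/dx) H_{2μ_k}^{β_k})((ℓ − α_k n)/n^{1/(2μ_k)}). -/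
open Complex

/-- Convolution of two complex-valued sequences over `ℤ`. -/
noncomputable def conv (a b : ℤ → ℂ) : ℤ → ℂ := fun ℓ => ∑' ℓ' : ℤ, a (ℓ - ℓ') * b ℓ'

/-- `iterConv a n` is the iterated convolution `a^{⋆(n+1)}`:
`iterConv a 0 = a^{⋆1} = a` and `iterConv a (n+1) = iterConv a n ⋆ a`. -/
noncomputable def iterConv (a : ℤ → ℂ) : ℕ → ℤ → ℂ
  | 0 => a
  | n + 1 => conv (iterConv a n) a

/-- The generalized Gaussian `H_{2μ}^β (x) = (1/2π) ∫_ℝ e^{-i x θ} e^{-β θ^{2μ}} dθ`. -/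
noncomputable def Hfun (μ : ℕ) (β : ℂ) : ℝ → ℂ :=
  fun x => (1 / (2 * Real.pi : ℂ)) *
    ∫ θ : ℝ, Complex.exp (-Complex.I * x * θ) * Complex.exp (-β * (θ : ℂ) ^ (2 * μ))

/-- The function `(P_m (-d/dx)) H` where
`P_m (X) = X^m ∑_{⟨ν⟩ = m} X^{2μ|ν|}/ν! ∏_{j ≥ 1} (γ_{2μ+j}/(2μ+j)!)^{ν_j}`,
the sum running over finitely supported sequences `ν` of nonnegative integers with
`⟨ν⟩ = ∑_j j ν_j = m`, encoded by partitions `p` of `m`; in particular `P_0 = 1`. -/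
noncomputable def PdiffH (μ : ℕ) (γ : ℕ → ℂ) (m : ℕ) (H : ℝ → ℂ) : ℝ → ℂ :=
  fun x => ∑ p : Nat.Partition m,
    (-1 : ℂ) ^ (m + 2 * μ * Multiset.card p.parts) *
      ((∏ j ∈ p.parts.toFinset, (Nat.factorial (Multiset.count j p.parts) : ℂ))⁻¹ *
        ∏ j ∈ p.parts.toFinset,
          (γ (2 * μ + j) / (Nat.factorial (2 * μ + j) : ℂ)) ^ Multiset.count j p.parts) *
      iteratedDeriv (m + 2 * μ * Multiset.card p.parts) H x


/-! ### Part 1 : expansion of the exponential along partitions -/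

noncomputable def pmc {𝕜 : Type*} [Field 𝕜] (c : ℕ → 𝕜) (w : 𝕜) (m : ℕ) : 𝕜 :=
  ∑ p : Nat.Partition m, w ^ (Multiset.card p.parts) *
      ((∏ j ∈ p.parts.toFinset, (Nat.factorial (Multiset.count j p.parts) : 𝕜))⁻¹ *
        ∏ j ∈ p.parts.toFinset, c j ^ Multiset.count j p.parts)

lemma pmc_eq_coeff (c : ℕ → ℂ) (w : ℂ) (m : ℕ) :
    pmc c w m = (Nat.Partition.genFun
      (fun j k => (w * c j) ^ k / (Nat.factorial k : ℂ))).coeff m := by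
  rw [Nat.Partition.coeff_genFun, pmc]
  refine Finset.sum_congr rfl fun p _ => ?_
  simp only [Finsupp.prod, Multiset.toFinsupp_support, Multiset.toFinsupp_apply]
  rw [Finset.prod_div_distrib]
  simp_rw [mul_pow]
  rw [Finset.prod_mul_distrib, Finset.prod_pow_eq_pow_sum, Multiset.toFinset_sum_count_eq]
  rw [div_eq_mul_inv]; ring

open scoped PowerSeries.WithPiTopology in
lemma genFun_eq_prod (M : ℕ) (f : ℕ → ℕ → ℂ) (hf : ∀ i, M ≤ i → ∀ j, f (i+1) (j+1) = 0)
    (hf0 : ∀ i, f i 0 = 1) :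
    Nat.Partition.genFun f = ∏ i ∈ Finset.range M,
      (PowerSeries.mk fun k => if (i+1) ∣ k then f (i+1) (k / (i+1)) else 0 : PowerSeries ℂ) := by
  have h1 := Nat.Partition.hasProd_genFun f
  have h2 : ∀ i, (1 + ∑' j, f (i + 1) (j + 1) • (PowerSeries.X : PowerSeries ℂ) ^ ((i + 1) * (j + 1)))
      = (PowerSeries.mk fun k => if (i+1) ∣ k then f (i+1) (k / (i+1)) else 0 : PowerSeries ℂ) := by
    intro i
    ext k
    rw [map_add, (Nat.Partition.summable_genFun_term f i).map_tsum _
      (PowerSeries.WithPiTopology.continuous_coeff _ _), PowerSeries.coeff_mk]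
    simp only [map_smul, PowerSeries.coeff_X_pow, PowerSeries.coeff_one, smul_eq_mul, mul_ite, mul_one, mul_zero]
    by_cases hk : k = 0
    · subst hk
      simp [hf0]
    · rw [if_neg hk, zero_add]
      split_ifs with hd
      · obtain ⟨q, rfl⟩ := hd
        have hq : q ≠ 0 := by rintro rfl; simp at hk
        rw [tsum_eq_single (q - 1)]
        · rw [if_pos, Nat.mul_div_cancel_left _ (Nat.succ_pos i), Nat.sub_add_cancel (Nat.pos_of_ne_zero hq)]
          rw [Nat.sub_add_cancel (Nat.pos_of_ne_zero hq)]
        · intro b hb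
          rw [if_neg]
          intro h
          have := Nat.eq_of_mul_eq_mul_left (Nat.succ_pos i) h
          omega
      · convert tsum_zero with j
        rw [if_neg]
        rintro rfl
        exact hd (dvd_mul_right _ _)
  simp_rw [h2] at h1
  refine h1.unique (hasProd_prod_of_ne_finset_one ?_)
  intro i hi
  have hi : M ≤ i := by simpa using hi
  rw [← h2]
  simp [hf i hi]

def GoodPS (x : ℂ) (G : PowerSeries ℂ) (S : ℂ) : Prop :=
  Summable (fun k => ‖G.coeff k * x ^ k‖) ∧ ∑' k, G.coeff k * x ^ k = S

lemma GoodPS.mul {x : ℂ} {G H : PowerSeries ℂ} {S T : ℂ} (hG : GoodPS x G S) (hH : GoodPS x H T) :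
    GoodPS x (G * H) (S * T) := by
  have key : ∀ n, (G * H).coeff n * x ^ n = ∑ kl ∈ Finset.HasAntidiagonal.antidiagonal n,
      (G.coeff kl.1 * x ^ kl.1) * (H.coeff kl.2 * x ^ kl.2) := by
    intro n
    rw [PowerSeries.coeff_mul, Finset.sum_mul]
    refine Finset.sum_congr rfl fun kl hkl => ?_
    rw [← Finset.HasAntidiagonal.mem_antidiagonal.mp hkl, pow_add]; ring
  have key' : (fun n => (G * H).coeff n * x ^ n) = fun n => ∑ kl ∈ Finset.HasAntidiagonal.antidiagonal n,
      (G.coeff kl.1 * x ^ kl.1) * (H.coeff kl.2 * x ^ kl.2) := funext key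
  have h1 := summable_norm_sum_mul_antidiagonal_of_summable_norm
    (f := fun k => G.coeff k * x ^ k) (g := fun k => H.coeff k * x ^ k) hG.1 hH.1
  have h2 := tsum_mul_tsum_eq_tsum_sum_antidiagonal_of_summable_norm
    (f := fun k => G.coeff k * x ^ k) (g := fun k => H.coeff k * x ^ k) hG.1 hH.1
  constructor
  · have : (fun n => ‖(G * H).coeff n * x ^ n‖) = fun n => ‖∑ kl ∈ Finset.HasAntidiagonal.antidiagonal n,
      (G.coeff kl.1 * x ^ kl.1) * (H.coeff kl.2 * x ^ kl.2)‖ := funext fun n => by rw [key]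
    rw [this]
    exact h1
  · rw [key', ← h2, hG.2, hH.2]

lemma GoodPS.one {x : ℂ} : GoodPS x 1 1 := by
  have : ∀ k, (1 : PowerSeries ℂ).coeff k * x ^ k = if k = 0 then 1 else 0 := by
    intro k
    rw [PowerSeries.coeff_one]
    split_ifs with h <;> simp [h]
  constructor
  · simp_rw [this]
    exact summable_of_ne_finset_zero (s := {0}) (by intro b hb; simp at hb; simp [hb])
  · simp_rw [this]; simp

lemma GoodPS.prod {x : ℂ} (s : Finset ℕ) {G : ℕ → PowerSeries ℂ} {S : ℕ → ℂ}
    (h : ∀ i ∈ s, GoodPS x (G i) (S i)) : GoodPS x (∏ i ∈ s, G i) (∏ i ∈ s, S i) := by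
  classical
  induction s using Finset.induction_on with
  | empty => simpa using GoodPS.one
  | insert a s ha ih =>
    rw [Finset.prod_insert ha, Finset.prod_insert ha]
    exact (h a (Finset.mem_insert_self _ _)).mul (ih fun i hi => h i (Finset.mem_insert_of_mem hi))

lemma goodPS_factor (x : ℂ) (d : ℂ) (i : ℕ) :
    GoodPS x (PowerSeries.mk fun k => if (i+1) ∣ k then d ^ (k / (i+1)) / (Nat.factorial (k / (i+1)) : ℂ) else 0)
      (Complex.exp (d * x ^ (i+1))) := by
  have hinj : Function.Injective (fun j : ℕ => (i+1) * j) := fun a b h =>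
    Nat.eq_of_mul_eq_mul_left (Nat.succ_pos i) h
  have hz : ∀ k ∉ Set.range (fun j : ℕ => (i+1) * j), ¬ (i+1) ∣ k := by
    rintro k hk ⟨q, rfl⟩
    exact hk ⟨q, rfl⟩
  have hcomp : ∀ j : ℕ, (PowerSeries.mk fun k => if (i+1) ∣ k then d ^ (k / (i+1)) / (Nat.factorial (k / (i+1)) : ℂ) else 0 : PowerSeries ℂ).coeff ((i+1)*j) * x ^ ((i+1)*j) = (d * x^(i+1)) ^ j / (Nat.factorial j : ℂ) := by
    intro j
    rw [PowerSeries.coeff_mk, if_pos (dvd_mul_right _ _), Nat.mul_div_cancel_left _ (Nat.succ_pos i),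
      mul_pow, pow_mul]
    ring
  constructor
  · rw [← hinj.summable_iff]
    · simp only [Function.comp_def]
      simp_rw [hcomp]
      exact NormedSpace.norm_expSeries_div_summable (𝔸 := ℂ) (d * x^(i+1))
    · intro k hk
      rw [PowerSeries.coeff_mk, if_neg (hz k hk)]; simp
  · have : HasSum (fun k => (PowerSeries.mk fun k => if (i+1) ∣ k then d ^ (k / (i+1)) / (Nat.factorial (k / (i+1)) : ℂ) else 0 : PowerSeries ℂ).coeff k * x ^ k) (Complex.exp (d * x ^ (i+1))) := by
      rw [← hinj.hasSum_iff]
      · simp only [Function.comp_def]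
        simp_rw [hcomp]
        rw [Complex.exp_eq_exp_ℂ]
        exact NormedSpace.expSeries_div_hasSum_exp (𝔸 := ℂ) (d * x^(i+1))
      · intro k hk
        rw [PowerSeries.coeff_mk, if_neg (hz k hk)]; simp
    exact this.tsum_eq

lemma pmc_hasSum (M : ℕ) (c : ℕ → ℂ) (hc : ∀ j, M < j → c j = 0) (w x : ℂ) :
    HasSum (fun m => pmc c w m * x ^ m)
      (Complex.exp (w * ∑ j ∈ Finset.range M, c (j+1) * x ^ (j+1))) := by
  have h := GoodPS.prod (x := x) (Finset.range M)
    (fun i _ => goodPS_factor x (w * c (i+1)) i)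
  have hg := genFun_eq_prod M (fun j k => (w * c j) ^ k / (Nat.factorial k : ℂ))
    (by intro i hi j; simp [hc (i+1) (by omega)]) (by simp)
  rw [← hg, ← Complex.exp_sum] at h
  simp_rw [pmc_eq_coeff]
  have e : (w * ∑ j ∈ Finset.range M, c (j+1) * x ^ (j+1)) =
    ∑ i ∈ Finset.range M, w * c (i + 1) * x ^ (i + 1) := by
    rw [Finset.mul_sum]; exact Finset.sum_congr rfl fun _ _ => by ring
  rw [e, ← h.2]
  exact h.1.of_norm.hasSum

lemma pmc_nonneg (c : ℕ → ℝ) (hc : ∀ j, 0 ≤ c j) (w : ℝ) (hw : 0 ≤ w) (m : ℕ) : 0 ≤ pmc c w m := by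
  unfold pmc
  refine Finset.sum_nonneg fun p _ => ?_
  refine mul_nonneg (pow_nonneg hw _) (mul_nonneg (inv_nonneg.2 (Finset.prod_nonneg fun _ _ => by positivity)) (Finset.prod_nonneg fun j _ => pow_nonneg (hc j) _))

lemma pmc_norm_le (c : ℕ → ℂ) (w : ℂ) (m : ℕ) : ‖pmc c w m‖ ≤ pmc (fun j => ‖c j‖) ‖w‖ m := by
  unfold pmc
  refine (norm_sum_le _ _).trans (le_of_eq (Finset.sum_congr rfl fun p _ => ?_))
  simp [norm_pow, norm_inv, norm_prod]

lemma pmc_ofReal (c : ℕ → ℝ) (w : ℝ) (m : ℕ) :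
    ((pmc c w m : ℝ) : ℂ) = pmc (fun j => (c j : ℂ)) (w : ℂ) m := by
  unfold pmc
  push_cast
  rfl

lemma pmc_hasSum_real (M : ℕ) (c : ℕ → ℝ) (hc : ∀ j, M < j → c j = 0) (w x : ℝ) :
    HasSum (fun m => pmc c w m * x ^ m)
      (Real.exp (w * ∑ j ∈ Finset.range M, c (j+1) * x ^ (j+1))) := by
  rw [← Complex.hasSum_ofReal]
  have := pmc_hasSum M (fun j => (c j : ℂ)) (by intro j hj; simp [hc j hj]) w x
  push_cast
  simpa [pmc_ofReal] using this

lemma pmc_congr {c d : ℕ → ℂ} (w : ℂ) {m : ℕ} (h : ∀ j, j ≤ m → c j = d j) : pmc c w m = pmc d w m := by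
  unfold pmc
  refine Finset.sum_congr rfl fun p _ => ?_
  congr 2
  refine Finset.prod_congr rfl fun j hj => ?_
  rw [h j]
  exact Nat.Partition.le_of_mem_parts (by simpa using hj)

lemma pmc_rem (M : ℕ) (c : ℕ → ℂ) (r : ℝ) (hr : 0 < r) (w : ℂ) :
    (∀ m, m ≤ M → ‖pmc c w m‖ * r ^ m ≤
      Real.exp (‖w‖ * ∑ j ∈ Finset.range M, ‖c (j+1)‖ * r ^ (j+1))) ∧
    ∀ x : ℂ, ‖x‖ ≤ r →
      ‖Complex.exp (w * ∑ j ∈ Finset.range M, c (j+1) * x ^ (j+1)) -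
        ∑ m ∈ Finset.range (M+1), pmc c w m * x ^ m‖ ≤
      (‖x‖ / r) ^ (M+1) * Real.exp (‖w‖ * ∑ j ∈ Finset.range M, ‖c (j+1)‖ * r ^ (j+1)) := by
  set d : ℕ → ℂ := fun j => if j ≤ M then c j else 0 with hd
  have hd0 : ∀ j, M < j → d j = 0 := fun j hj => if_neg (by omega)
  have hcd : ∀ m ≤ M, pmc c w m = pmc d w m := fun m hm =>
    pmc_congr w fun j hj => by simp [hd, hj.trans hm]
  have hS : ∀ x : ℂ, ∑ j ∈ Finset.range M, c (j+1) * x ^ (j+1) = ∑ j ∈ Finset.range M, d (j+1) * x ^ (j+1) := by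
    intro x
    refine Finset.sum_congr rfl fun j hj => ?_
    have : j + 1 ≤ M := by simpa using hj
    simp [hd, this]
  have hSr : ∑ j ∈ Finset.range M, ‖c (j+1)‖ * r ^ (j+1) = ∑ j ∈ Finset.range M, ‖d (j+1)‖ * r ^ (j+1) := by
    refine Finset.sum_congr rfl fun j hj => ?_
    have : j + 1 ≤ M := by simpa using hj
    simp [hd, this]
  have hR := pmc_hasSum_real M (fun j => ‖d j‖) (by intro j hj; simp [hd0 j hj]) ‖w‖ r
  have hnn : ∀ m, 0 ≤ pmc (fun j => ‖d j‖) ‖w‖ m := pmc_nonneg _ (fun _ => norm_nonneg _) _ (norm_nonneg _)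
  rw [hSr]
  constructor
  · intro m hm
    rw [hcd m hm]
    calc ‖pmc d w m‖ * r ^ m ≤ pmc (fun j => ‖d j‖) ‖w‖ m * r ^ m := by
          gcongr; exact pmc_norm_le _ _ _
      _ ≤ _ := le_hasSum hR m fun j _ => mul_nonneg (hnn j) (by positivity)
  · intro x hx
    rw [hS]
    have hC := pmc_hasSum M d hd0 w x
    have hsum : ∑ m ∈ Finset.range (M+1), pmc c w m * x ^ m = ∑ m ∈ Finset.range (M+1), pmc d w m * x ^ m :=
      Finset.sum_congr rfl fun m hm => by rw [hcd m (by simpa [Nat.lt_succ_iff] using hm)]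
    rw [hsum]
    have hC' := (hasSum_nat_add_iff' (M+1)).2 hC
    rw [← hC'.tsum_eq]
    have hR' : HasSum (fun m => (‖x‖/r)^(M+1) * (pmc (fun j => ‖d j‖) ‖w‖ (m + (M+1)) * r ^ (m + (M+1)))) _ :=
      ((hasSum_nat_add_iff' (M+1)).2 hR).mul_left _
    refine (tsum_of_norm_bounded hR' fun m => ?_).trans ?_
    · rw [norm_mul, norm_pow, pow_add, div_pow]
      have : ‖x‖ ^ (M + 1) / r ^ (M + 1) * (pmc (fun j => ‖d j‖) ‖w‖ (m + (M + 1)) * r ^ (m + (M + 1)))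
        = pmc (fun j => ‖d j‖) ‖w‖ (m + (M + 1)) * (r ^ m * ‖x‖^(M+1)) := by
        rw [pow_add r m]; field_simp
      rw [this]
      gcongr
      · exact hnn _
      · exact pmc_norm_le _ _ _
    · gcongr
      have : 0 ≤ ∑ i ∈ Finset.range (M+1), pmc (fun j => ‖d j‖) ‖w‖ i * r ^ i :=
        Finset.sum_nonneg fun j _ => mul_nonneg (hnn j) (by positivity)
      linarith


/-! ### Part 2 : the generalized Gaussians -/

lemma abs_sub_one_le_pow (μ : ℕ) (hμ : 1 ≤ μ) (x : ℝ) : |x| - 1 ≤ x ^ (2 * μ) := by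
  by_cases h : |x| ≤ 1
  · have : 0 ≤ x ^ (2*μ) := by rw [pow_mul]; positivity
    linarith
  · push Not at h
    have h1 : x ^ (2*μ) = |x| ^ (2*μ) := by rw [pow_mul, pow_mul, sq_abs]
    rw [h1]
    have : |x| ≤ |x| ^ (2*μ) := le_self_pow₀ h.le (by omega)
    linarith

lemma pow_mul_exp_neg_le (b : ℝ) (hb : 0 < b) (q : ℕ) (y : ℝ) (hy : 0 ≤ y) :
    y ^ q * Real.exp (-b * y) ≤ q.factorial / b ^ q := by
  have h := Real.pow_div_factorial_le_exp (b * y) (by positivity) q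
  rw [neg_mul, Real.exp_neg]
  rw [div_le_iff₀ (by positivity), mul_pow] at h
  rw [le_div_iff₀ (by positivity), mul_right_comm, ← div_eq_mul_inv, div_le_iff₀ (Real.exp_pos _)]
  linarith

lemma abs_pow_mul_gauss_le (μ : ℕ) (hμ : 1 ≤ μ) (b : ℝ) (hb : 0 < b) (q : ℕ) (x : ℝ) :
    |x| ^ q * Real.exp (-b * x ^ (2*μ)) ≤ Real.exp b * (q.factorial / b ^ q) := by
  have h1 : Real.exp (-b * x ^ (2*μ)) ≤ Real.exp b * Real.exp (-b * |x|) := by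
    rw [← Real.exp_add]
    apply Real.exp_le_exp.2
    nlinarith [abs_sub_one_le_pow μ hμ x]
  calc _ ≤ |x| ^ q * (Real.exp b * Real.exp (-b * |x|)) := by gcongr
    _ = Real.exp b * (|x| ^ q * Real.exp (-b * |x|)) := by ring
    _ ≤ _ := by gcongr; exact pow_mul_exp_neg_le b hb q _ (abs_nonneg x)

noncomputable def gau (μ : ℕ) (β : ℂ) (x : ℝ) : ℂ := Complex.exp (-β * (x : ℂ) ^ (2 * μ))

lemma norm_gau (μ : ℕ) (β : ℂ) (x : ℝ) : ‖gau μ β x‖ = Real.exp (-β.re * x ^ (2*μ)) := by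
  rw [gau, Complex.norm_exp]
  congr 1
  rw [← Complex.ofReal_pow, Complex.re_mul_ofReal, Complex.neg_re]

lemma gau_contDiff (μ : ℕ) (β : ℂ) : ContDiff ℝ ⊤ (gau μ β) := by
  unfold gau
  have : ContDiff ℝ ⊤ (fun x : ℝ => (x : ℂ)) := Complex.ofRealCLM.contDiff
  exact (contDiff_const.mul (this.pow _)).cexp

lemma gau_iteratedDeriv (μ : ℕ) (β : ℂ) (k : ℕ) :
    ∃ P : Polynomial ℂ, iteratedDeriv k (gau μ β) = fun x : ℝ => P.eval (x : ℂ) * gau μ β x := by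
  induction k with
  | zero => exact ⟨1, by simp⟩
  | succ k ih =>
    obtain ⟨P, hP⟩ := ih
    refine ⟨Polynomial.derivative P + P * (Polynomial.C (-β) * (Polynomial.C (2 * μ : ℂ) * Polynomial.X ^ (2*μ-1))), ?_⟩
    rw [iteratedDeriv_succ, hP]
    funext x
    have h1 : HasDerivAt (fun x : ℝ => P.eval (x : ℂ)) (P.derivative.eval (x:ℂ)) x :=
      (P.hasDerivAt (x:ℂ)).comp_ofReal
    have h2 : HasDerivAt (gau μ β) (Complex.exp (-β * (x:ℂ)^(2*μ)) * (-β * ((2*μ : ℕ) * (x:ℂ)^(2*μ-1)))) x := by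
      have := (((hasDerivAt_pow (2*μ) (x:ℂ)).const_mul (-β)).cexp).comp_ofReal
      exact this
    have h3 := h1.fun_mul h2
    rw [h3.deriv]
    simp [gau]
    ring

lemma pow_mul_poly_gau_le (μ : ℕ) (hμ : 1 ≤ μ) (β : ℂ) (hβ : 0 < β.re) (q : ℕ) (P : Polynomial ℂ) :
    ∃ C : ℝ, ∀ x : ℝ, |x| ^ q * ‖P.eval (x:ℂ) * gau μ β x‖ ≤ C := by
  induction P using Polynomial.induction_on' with
  | add P Q hP hQ =>
    obtain ⟨C, hC⟩ := hP
    obtain ⟨D, hD⟩ := hQ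
    refine ⟨C + D, fun x => ?_⟩
    calc _ ≤ |x| ^ q * (‖P.eval (x:ℂ) * gau μ β x‖ + ‖Q.eval (x:ℂ) * gau μ β x‖) := by
          gcongr
          rw [Polynomial.eval_add, add_mul]
          exact norm_add_le _ _
      _ ≤ _ := by rw [mul_add]; exact add_le_add (hC x) (hD x)
  | monomial n a =>
    refine ⟨‖a‖ * (Real.exp β.re * ((q+n).factorial / β.re ^ (q+n))), fun x => ?_⟩
    have := abs_pow_mul_gauss_le μ hμ β.re hβ (q+n) x
    rw [norm_mul, norm_gau, Polynomial.eval_monomial, norm_mul, norm_pow, Complex.norm_real, Real.norm_eq_abs]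
    calc _ = ‖a‖ * (|x| ^ (q+n) * Real.exp (-β.re * x ^ (2*μ))) := by rw [pow_add]; ring
      _ ≤ _ := by gcongr

noncomputable def gauS (μ : ℕ) (hμ : 1 ≤ μ) (β : ℂ) (hβ : 0 < β.re) : SchwartzMap ℝ ℂ where
  toFun := gau μ β
  smooth' := (gau_contDiff μ β).of_le le_top
  decay' := by
    intro k n
    obtain ⟨P, hP⟩ := gau_iteratedDeriv μ β n
    obtain ⟨C, hC⟩ := pow_mul_poly_gau_le μ hμ β hβ k P
    refine ⟨C, fun x => ?_⟩
    rw [norm_iteratedFDeriv_eq_norm_iteratedDeriv, hP]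
    exact hC x

open scoped FourierTransform in
lemma Hfun_eq (μ : ℕ) (hμ : 1 ≤ μ) (β : ℂ) (hβ : 0 < β.re) :
    Hfun μ β = fun x : ℝ => (1 / (2 * Real.pi : ℂ)) *
      (𝓕 (gauS μ hμ β hβ) : SchwartzMap ℝ ℂ) ((2 * Real.pi)⁻¹ * x) := by
  funext x
  rw [Hfun, SchwartzMap.fourier_coe, Real.fourier_real_eq_integral_exp_smul]
  congr 1
  refine MeasureTheory.integral_congr_ae (Filter.Eventually.of_forall fun θ => ?_)
  have : (gauS μ hμ β hβ) θ = gau μ β θ := rfl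
  simp only [this, smul_eq_mul, gau]
  congr 2
  push_cast
  have : (Real.pi : ℂ) ≠ 0 := by exact_mod_cast Real.pi_ne_zero
  field_simp

open scoped FourierTransform in
lemma iteratedDeriv_Hfun (μ : ℕ) (hμ : 1 ≤ μ) (β : ℂ) (hβ : 0 < β.re) (j : ℕ) (x : ℝ) :
    iteratedDeriv j (Hfun μ β) x = (1 / (2 * Real.pi : ℂ)) * ((((2 * Real.pi)⁻¹ : ℝ) : ℂ) ^ j *
      iteratedDeriv j (𝓕 (gauS μ hμ β hβ) : SchwartzMap ℝ ℂ) ((2 * Real.pi)⁻¹ * x)) := by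
  rw [Hfun_eq μ hμ β hβ]
  have hs : ContDiff ℝ j (𝓕 (gauS μ hμ β hβ) : SchwartzMap ℝ ℂ) :=
    ((𝓕 (gauS μ hμ β hβ) : SchwartzMap ℝ ℂ).smooth (⊤ : ℕ∞)).of_le (by exact_mod_cast le_top)
  have h2 := iteratedDeriv_comp_const_smul hs ((2 * Real.pi)⁻¹)
  rw [iteratedDeriv_const_mul_field]
  congr 1
  rw [congrFun h2 x, Complex.real_smul, Complex.ofReal_pow]

open scoped FourierTransform in
lemma Hfun_decay (μ : ℕ) (hμ : 1 ≤ μ) (β : ℂ) (hβ : 0 < β.re) (j q : ℕ) :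
    ∃ C : ℝ, ∀ x : ℝ, |x| ^ q * ‖iteratedDeriv j (Hfun μ β) x‖ ≤ C := by
  have h := SchwartzMap.le_seminorm' ℝ q j (𝓕 (gauS μ hμ β hβ) : SchwartzMap ℝ ℂ)
  set S := (SchwartzMap.seminorm ℝ q j) (𝓕 (gauS μ hμ β hβ) : SchwartzMap ℝ ℂ)
  refine ⟨(2*Real.pi)^q * (‖(1 / (2 * Real.pi : ℂ))‖ * (‖(((2 * Real.pi)⁻¹ : ℝ) : ℂ) ^ j‖ * S)), fun x => ?_⟩
  rw [iteratedDeriv_Hfun μ hμ β hβ, norm_mul, norm_mul]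
  have h1 := h ((2 * Real.pi)⁻¹ * x)
  have e : |x| ^ q = (2*Real.pi)^q * |(2 * Real.pi)⁻¹ * x| ^ q := by
    rw [← mul_pow, abs_mul, abs_of_pos (by positivity : 0 < (2 * Real.pi)⁻¹), ← mul_assoc,
      mul_inv_cancel₀ (by positivity), one_mul]
  rw [e]
  generalize ‖iteratedDeriv j (𝓕 (gauS μ hμ β hβ) : SchwartzMap ℝ ℂ) ((2 * Real.pi)⁻¹ * x)‖ = y at *
  calc _ = (2*Real.pi)^q * (‖(1 / (2 * Real.pi : ℂ))‖ * (‖(((2 * Real.pi)⁻¹ : ℝ) : ℂ) ^ j‖ * (|(2 * Real.pi)⁻¹ * x| ^ q * y))) := by ring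
    _ ≤ _ := by gcongr

lemma pow_gau_integrable (μ : ℕ) (hμ : 1 ≤ μ) (β : ℂ) (hβ : 0 < β.re) (j : ℕ) :
    MeasureTheory.Integrable (fun x : ℝ => (x:ℂ) ^ j * gau μ β x) := by
  have := (gauS μ hμ β hβ).integrable_pow_mul MeasureTheory.volume j
  have hm : Continuous (fun x : ℝ => (x:ℂ) ^ j * gau μ β x) := by
    unfold gau; fun_prop
  refine MeasureTheory.Integrable.mono' this hm.aestronglyMeasurable ?_
  refine Filter.Eventually.of_forall fun x => le_of_eq ?_
  rw [norm_mul, norm_pow, Complex.norm_real]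
  rfl

open scoped FourierTransform in
lemma iteratedDeriv_Hfun_integral (μ : ℕ) (hμ : 1 ≤ μ) (β : ℂ) (hβ : 0 < β.re) (j : ℕ) (x : ℝ) :
    iteratedDeriv j (Hfun μ β) x = (1 / (2 * Real.pi : ℂ)) *
      ∫ θ : ℝ, Complex.exp (-Complex.I * x * θ) * ((-Complex.I * θ) ^ j * gau μ β θ) := by
  rw [iteratedDeriv_Hfun μ hμ β hβ, SchwartzMap.fourier_coe]
  congr 1
  have hf : ∀ n : ℕ, (n : ℕ∞) ≤ (⊤ : ℕ∞) → MeasureTheory.Integrable (fun x : ℝ ↦ x ^ n • (gauS μ hμ β hβ : ℝ → ℂ) x) := by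
    intro n _
    have := pow_gau_integrable μ hμ β hβ n
    refine this.congr (Filter.Eventually.of_forall fun x => ?_)
    simp only [Complex.real_smul, Complex.ofReal_pow]
    rfl
  rw [Real.iteratedDeriv_fourier hf le_top, Real.fourier_real_eq_integral_exp_smul,
    ← MeasureTheory.integral_const_mul]
  refine MeasureTheory.integral_congr_ae (Filter.Eventually.of_forall fun θ => ?_)
  have h0 : (gauS μ hμ β hβ) θ = gau μ β θ := rfl
  have hpi : (Real.pi : ℂ) ≠ 0 := by exact_mod_cast Real.pi_ne_zero
  simp only [h0, smul_eq_mul]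
  have e1 : Complex.exp (((-2 * Real.pi * θ * ((2 * Real.pi)⁻¹ * x) : ℝ) : ℂ) * Complex.I) = Complex.exp (-Complex.I * x * θ) := by
    congr 1
    push_cast
    field_simp
  rw [e1]
  have e2 : (-Complex.I * (θ:ℂ)) = (((2 * Real.pi)⁻¹ : ℝ) : ℂ) * (-2 * Real.pi * Complex.I * θ) := by
    push_cast
    field_simp
  rw [e2, mul_pow]
  ring

lemma PdiffH_decay (μ : ℕ) (hμ : 1 ≤ μ) (β : ℂ) (hβ : 0 < β.re) (γ : ℕ → ℂ) (m q : ℕ) :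
    ∃ C : ℝ, 0 ≤ C ∧ ∀ x : ℝ, |x| ^ q * ‖PdiffH μ γ m (Hfun μ β) x‖ ≤ C := by
  choose C hC using fun j => Hfun_decay μ hμ β hβ j q
  have hC0 : ∀ j, 0 ≤ C j := fun j => le_trans (by positivity) (hC j 0)
  refine ⟨∑ p : Nat.Partition m, ‖(-1 : ℂ) ^ (m + 2 * μ * Multiset.card p.parts) *
      ((∏ j ∈ p.parts.toFinset, (Nat.factorial (Multiset.count j p.parts) : ℂ))⁻¹ *
        ∏ j ∈ p.parts.toFinset,
          (γ (2 * μ + j) / (Nat.factorial (2 * μ + j) : ℂ)) ^ Multiset.count j p.parts)‖ * C (m + 2 * μ * Multiset.card p.parts),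
      Finset.sum_nonneg fun p _ => mul_nonneg (norm_nonneg _) (hC0 _), fun x => ?_⟩
  unfold PdiffH
  refine (mul_le_mul_of_nonneg_left (norm_sum_le _ _) (by positivity)).trans ?_
  rw [Finset.mul_sum]
  refine Finset.sum_le_sum fun p _ => ?_
  rw [norm_mul, mul_left_comm]
  gcongr
  exact hC _ x

noncomputable def cgam (μ : ℕ) (γ : ℕ → ℂ) (j : ℕ) : ℂ := γ (2 * μ + j) / (Nat.factorial (2 * μ + j) : ℂ)

/-- main Fourier-side integrand -/
noncomputable def ker (μ : ℕ) (β : ℂ) (γ : ℕ → ℂ) (m n : ℕ) (ξ : ℝ) : ℂ :=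
  pmc (cgam μ γ) (n * (Complex.I * ξ) ^ (2*μ)) m * (Complex.I * ξ) ^ m * gau μ (n * β) ξ

lemma rpow_inv_pow (μ : ℕ) (hμ : 1 ≤ μ) (n : ℕ) : ((n : ℝ) ^ ((1:ℝ) / (2 * μ))) ^ (2 * μ) = n := by
  rw [← Real.rpow_natCast, ← Real.rpow_mul (by positivity)]
  have : (μ : ℝ) ≠ 0 := by positivity
  rw [show (1:ℝ) / (2 * μ) * ((2 * μ : ℕ) : ℝ) = 1 by push_cast; field_simp, Real.rpow_one]

lemma rpow_scale (μ : ℕ) (n : ℕ) (m : ℕ) :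
    (n : ℝ) ^ (-((m : ℝ) + 1) / (2 * (μ : ℝ))) = (((n : ℝ) ^ ((1:ℝ) / (2 * μ))) ^ (m + 1))⁻¹ := by
  rw [← Real.rpow_natCast, ← Real.rpow_mul (by positivity), ← Real.rpow_neg (by positivity)]
  congr 1
  push_cast
  ring

lemma scaled_PdiffH (μ : ℕ) (hμ : 1 ≤ μ) (β : ℂ) (hβ : 0 < β.re) (γ : ℕ → ℂ) (m n : ℕ) (hn : 1 ≤ n) (y : ℝ) :
    (((n : ℝ) ^ (-((m : ℝ) + 1) / (2 * (μ : ℝ))) : ℝ) : ℂ) *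
      PdiffH μ γ m (Hfun μ β) (y / (n : ℝ) ^ ((1 : ℝ) / (2 * (μ : ℝ)))) =
    (1 / (2 * Real.pi : ℂ)) * ∫ ξ : ℝ, Complex.exp (-Complex.I * y * ξ) * ker μ β γ m n ξ := by
  set N : ℝ := (n : ℝ) ^ ((1 : ℝ) / (2 * (μ : ℝ))) with hN
  have hNpos : 0 < N := by rw [hN]; apply Real.rpow_pos_of_pos; positivity
  have hNn : N ^ (2*μ) = n := rpow_inv_pow μ hμ n
  rw [rpow_scale μ n m, ← hN]
  unfold PdiffH
  simp_rw [iteratedDeriv_Hfun_integral μ hμ β hβ]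
  -- integral over θ, then scale
  have hIntg : ∀ (j : ℕ), MeasureTheory.Integrable (fun ξ : ℝ => Complex.exp (-Complex.I * ((y / N : ℝ) : ℂ) * ξ) * ((-Complex.I * ξ) ^ j * gau μ β ξ)) := by
    intro j
    refine ((pow_gau_integrable μ hμ β hβ j).norm).mono' (by unfold gau; fun_prop) (Filter.Eventually.of_forall fun ξ => le_of_eq ?_)
    have : ‖Complex.exp (-Complex.I * ((y / N : ℝ) : ℂ) * ξ)‖ = 1 := by
      rw [show -Complex.I * ((y / N : ℝ) : ℂ) * ξ = ((-(y / N) * ξ : ℝ) : ℂ) * Complex.I by push_cast; ring]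
      exact Complex.norm_exp_ofReal_mul_I _
    rw [norm_mul, this, one_mul, norm_mul, norm_mul, norm_pow, norm_pow, norm_mul, norm_neg, Complex.norm_I, one_mul]
  have hscale : ∀ g : ℝ → ℂ, ∫ θ : ℝ, g θ = N * ∫ ξ : ℝ, g (N * ξ) := by
    intro g
    rw [MeasureTheory.Measure.integral_comp_mul_left, abs_of_pos (by positivity), Complex.real_smul,
      ← mul_assoc, ← Complex.ofReal_mul, mul_inv_cancel₀ hNpos.ne', Complex.ofReal_one, one_mul]
  have hcomb : ∑ p : Nat.Partition m,
    (-1 : ℂ) ^ (m + 2 * μ * Multiset.card p.parts) *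
      ((∏ j ∈ p.parts.toFinset, (Nat.factorial (Multiset.count j p.parts) : ℂ))⁻¹ *
        ∏ j ∈ p.parts.toFinset,
          (γ (2 * μ + j) / (Nat.factorial (2 * μ + j) : ℂ)) ^ Multiset.count j p.parts) *
      ((1 / (2 * Real.pi : ℂ)) *
      ∫ θ : ℝ, Complex.exp (-Complex.I * ((y / N : ℝ) : ℂ) * θ) * ((-Complex.I * θ) ^ (m + 2 * μ * Multiset.card p.parts) * gau μ β θ))
     = (1 / (2 * Real.pi : ℂ)) * ∫ θ : ℝ, ∑ p : Nat.Partition m,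
    ((-1 : ℂ) ^ (m + 2 * μ * Multiset.card p.parts) *
      ((∏ j ∈ p.parts.toFinset, (Nat.factorial (Multiset.count j p.parts) : ℂ))⁻¹ *
        ∏ j ∈ p.parts.toFinset,
          (γ (2 * μ + j) / (Nat.factorial (2 * μ + j) : ℂ)) ^ Multiset.count j p.parts)) *
      (Complex.exp (-Complex.I * ((y / N : ℝ) : ℂ) * θ) * ((-Complex.I * θ) ^ (m + 2 * μ * Multiset.card p.parts) * gau μ β θ)) := by
    rw [MeasureTheory.integral_finsetSum _ (fun p _ => (hIntg _).const_mul _), Finset.mul_sum]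
    refine Finset.sum_congr rfl fun p _ => ?_
    rw [MeasureTheory.integral_const_mul]
    ring
  rw [hcomb, hscale, mul_left_comm, ← MeasureTheory.integral_const_mul, ← MeasureTheory.integral_const_mul]
  congr 1
  refine MeasureTheory.integral_congr_ae (Filter.Eventually.of_forall fun ξ => ?_)
  have hNc : (N : ℂ) ≠ 0 := by exact_mod_cast hNpos.ne'
  have hNnc : (N : ℂ) ^ (2*μ) = n := by exact_mod_cast hNn
  simp only [ker, pmc]
  rw [Finset.sum_mul, Finset.sum_mul, Finset.mul_sum, Finset.mul_sum, Finset.mul_sum]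
  refine Finset.sum_congr rfl fun p _ => ?_
  have e1 : Complex.exp (-Complex.I * ((y / N : ℝ) : ℂ) * ((N * ξ : ℝ) : ℂ)) = Complex.exp (-Complex.I * y * ξ) := by
    congr 1
    push_cast
    field_simp
  have e2 : gau μ β (N * ξ) = gau μ (n * β) ξ := by
    unfold gau
    congr 1
    push_cast
    rw [mul_pow, hNnc]; ring
  rw [e1, e2]
  have e3 : (-1 : ℂ) ^ (m + 2 * μ * Multiset.card p.parts) * (-Complex.I * ((N * ξ : ℝ) : ℂ)) ^ (m + 2 * μ * Multiset.card p.parts)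
      = (N : ℂ) ^ m * (Complex.I * ξ) ^ m * (n * (Complex.I * ξ) ^ (2*μ)) ^ (Multiset.card p.parts) := by
    rw [← mul_pow, ← hNnc, ← mul_pow, ← mul_pow, ← pow_mul, ← pow_add]
    congr 1
    push_cast
    ring
  have e4 : ((((N ^ (m+1))⁻¹ : ℝ)) : ℂ) * N * N ^ m = 1 := by
    push_cast
    field_simp
    ring
  simp only [cgam]
  set A := (∏ j ∈ p.parts.toFinset, (Nat.factorial (Multiset.count j p.parts) : ℂ))⁻¹ *
        ∏ j ∈ p.parts.toFinset,
          (γ (2 * μ + j) / (Nat.factorial (2 * μ + j) : ℂ)) ^ Multiset.count j p.parts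
  set E := Complex.exp (-Complex.I * y * ξ)
  set G := gau μ (n * β) ξ
  calc _ = ((((N ^ (m+1))⁻¹ : ℝ)) : ℂ) * N * ((-1 : ℂ) ^ (m + 2 * μ * Multiset.card p.parts) * (-Complex.I * ((N * ξ : ℝ) : ℂ)) ^ (m + 2 * μ * Multiset.card p.parts)) * A * E * G := by ring
    _ = (((((N ^ (m+1))⁻¹ : ℝ)) : ℂ) * N * N ^ m) * ((Complex.I * ξ) ^ m * (n * (Complex.I * ξ) ^ (2*μ)) ^ (Multiset.card p.parts)) * A * E * G := by rw [e3]; ring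
    _ = _ := by rw [e4]; ring

lemma ker_continuous (μ : ℕ) (β : ℂ) (γ : ℕ → ℂ) (m n : ℕ) : Continuous (ker μ β γ m n) := by
  unfold ker pmc gau
  fun_prop


/-! ### Part 3 : local expansion -/

lemma ker_sum_integrable (μ : ℕ) (hμ : 1 ≤ μ) (β : ℂ) (hβ : 0 < β.re) (γ : ℕ → ℂ) (m n : ℕ) (hn : 1 ≤ n) :
    MeasureTheory.Integrable (ker μ β γ m n) := by
  have hb : 0 < ((n : ℂ) * β).re := by
    rw [← Complex.ofReal_natCast, Complex.re_ofReal_mul]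
    have : (0:ℝ) < n := by exact_mod_cast hn
    positivity
  have : ker μ β γ m n = fun ξ : ℝ => ∑ p : Nat.Partition m,
      ((n * Complex.I ^ (2*μ)) ^ (Multiset.card p.parts) *
      ((∏ j ∈ p.parts.toFinset, (Nat.factorial (Multiset.count j p.parts) : ℂ))⁻¹ *
        ∏ j ∈ p.parts.toFinset, cgam μ γ j ^ Multiset.count j p.parts) * Complex.I ^ m) *
      ((ξ:ℂ) ^ (2 * μ * (Multiset.card p.parts) + m) * gau μ (n * β) ξ) := by
    funext ξ
    unfold ker pmc
    rw [Finset.sum_mul, Finset.sum_mul]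
    refine Finset.sum_congr rfl fun p _ => ?_
    have e1 : (ξ:ℂ) ^ (2 * μ * (Multiset.card p.parts) + m) = ((ξ:ℂ)^(2*μ)) ^ (Multiset.card p.parts) * (ξ:ℂ)^m := by
      rw [pow_add, pow_mul]
    have e2 : ((n:ℂ) * (Complex.I * ξ) ^ (2*μ)) ^ (Multiset.card p.parts) =
        (n * Complex.I ^ (2*μ)) ^ (Multiset.card p.parts) * ((ξ:ℂ)^(2*μ)) ^ (Multiset.card p.parts) := by
      rw [← mul_pow, mul_pow Complex.I, mul_assoc]
    rw [e1, e2, mul_pow Complex.I]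
    ring
  rw [this]
  exact MeasureTheory.integrable_finsetSum _ fun p _ => (pow_gau_integrable μ hμ _ hb _).const_mul _

lemma norm_exp_sub_one_le' (u : ℂ) : ‖Complex.exp u - 1‖ ≤ ‖u‖ * Real.exp ‖u‖ := by
  have := Complex.norm_exp_sub_sum_le_norm_mul_exp u 1
  simpa using this

lemma local_bound (μ : ℕ) (β : ℂ) (hβ : 0 < β.re) (γ : ℕ → ℂ)
    (hγlow : ∀ ν : ℕ, ν < 2 * μ + 1 → γ ν = 0) (A : ℂ) (hA : ‖A‖ = 1) (α : ℝ) (Φ : ℂ → ℂ)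
    (ρ : ℝ) (hρ : 0 < ρ)
    (hexp : ∀ ξ : ℂ, ‖ξ‖ < ρ → ∃ s : ℂ,
      HasSum (fun ν : ℕ => γ ν * (Complex.I * ξ) ^ ν / (Nat.factorial ν : ℂ)) s ∧
      Φ ξ = A * Complex.exp (Complex.I * α * ξ - β * ξ ^ (2 * μ) + s)) (M : ℕ) :
    ∃ r : ℝ, 0 < r ∧ r < ρ ∧ ∃ C : ℝ, 0 ≤ C ∧
      (∀ n : ℕ, ∀ ξ : ℝ, |ξ| ≤ r →
        ‖Φ ξ ^ n - A ^ n * Complex.exp (Complex.I * α * n * ξ) *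
          ∑ m ∈ Finset.range (M+1), ker μ β γ m n ξ‖ ≤
        C * |ξ| ^ (M+1) * Real.exp (-(β.re/4) * (n * ξ ^ (2*μ)))) ∧
      (∀ n : ℕ, ∀ ξ : ℝ, ∀ m ≤ M,
        ‖ker μ β γ m n ξ‖ ≤ (|ξ| / r) ^ m * Real.exp (-(β.re/4) * (n * ξ ^ (2*μ)))) := by
  set b := β.re with hb
  set c := cgam μ γ with hc
  obtain ⟨r0, hr0⟩ : ∃ x : ℝ, x = ρ / 2 := ⟨_, rfl⟩
  have hr0pos : 0 < r0 := by rw [hr0]; positivity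
  -- summability of coefficients
  have hc0 : c 0 = 0 := by simp [hc, cgam, hγlow (2*μ) (by omega)]
  have hsumc : ∀ ξ : ℂ, ‖ξ‖ < ρ → ∃ t : ℂ, HasSum (fun j => c j * (Complex.I * ξ) ^ j) t ∧
      Φ ξ = A * Complex.exp (Complex.I * α * ξ - β * ξ ^ (2 * μ) + (Complex.I * ξ) ^ (2*μ) * t) := by
    intro ξ hξ
    obtain ⟨s, hs, hΦ⟩ := hexp ξ hξ
    by_cases h0 : ξ = 0
    · refine ⟨0, ?_, ?_⟩
      · have : (fun j => c j * (Complex.I * ξ) ^ j) = fun _ => 0 := by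
          funext j
          rcases Nat.eq_zero_or_pos j with rfl | hj
          · simp [hc0]
          · simp [h0, hj.ne']
        rw [this]; exact hasSum_zero
      · have : s = 0 := by
          refine hs.unique ?_
          have : (fun ν : ℕ => γ ν * (Complex.I * ξ) ^ ν / (Nat.factorial ν : ℂ)) = fun _ => 0 := by
            funext j
            rcases Nat.eq_zero_or_pos j with rfl | hj
            · simp [hγlow 0 (by omega)]
            · simp [h0, hj.ne']
          rw [this]; exact hasSum_zero
        rw [hΦ, this, mul_zero]
    · have hz : (Complex.I * ξ) ≠ 0 := mul_ne_zero Complex.I_ne_zero h0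
      have h1 := (hasSum_nat_add_iff' (2*μ)).2 hs
      have h2 : ∑ i ∈ Finset.range (2*μ), γ i * (Complex.I * ξ) ^ i / (Nat.factorial i : ℂ) = 0 := by
        refine Finset.sum_eq_zero fun i hi => ?_
        rw [hγlow i (by have := Finset.mem_range.1 hi; omega)]; simp
      rw [h2, sub_zero] at h1
      refine ⟨s / (Complex.I * ξ) ^ (2*μ), ?_, ?_⟩
      · have h3 := h1.div_const ((Complex.I * ξ) ^ (2*μ))
        refine h3.congr_fun ?_
        intro j
        simp only [hc, cgam]
        rw [pow_add, add_comm j]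
        field_simp
      · rw [hΦ, mul_div_cancel₀ _ (pow_ne_zero _ hz)]
  have hsr0 : Summable (fun j => ‖c j‖ * r0 ^ j) := by
    obtain ⟨t, ht, _⟩ := hsumc (r0 : ℂ) (by rw [Complex.norm_real, Real.norm_eq_abs, abs_of_pos hr0pos]; linarith)
    refine ht.summable.norm.congr fun j => ?_
    rw [norm_mul, norm_pow, norm_mul, Complex.norm_I, one_mul, Complex.norm_real, Real.norm_eq_abs, abs_of_pos hr0pos]
  set T := ∑' j, ‖c j‖ * r0 ^ j with hT
  have hT0 : 0 ≤ T := tsum_nonneg fun j => by positivity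
  set q : ℝ := min 1 (b / (4 * (T+1))) with hq
  have hqpos : 0 < q := by rw [hq]; apply lt_min one_pos; positivity
  have hq1 : q ≤ 1 := min_le_left _ _
  have hqT : q * T ≤ b / 4 := by
    have : q ≤ b / (4 * (T+1)) := min_le_right _ _
    calc q * T ≤ b / (4 * (T+1)) * (T+1) := by gcongr; linarith
      _ = b / 4 := by field_simp
  set r := r0 * q with hr
  have hrpos : 0 < r := by positivity
  have hrr0 : r ≤ r0 := by rw [hr]; nlinarith
  have hsig : ∀ y : ℝ, 0 ≤ y → y ≤ r → ∑ j ∈ Finset.range M, ‖c (j+1)‖ * y ^ (j+1) ≤ b / 4 := by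
    intro y hy0 hy
    calc ∑ j ∈ Finset.range M, ‖c (j+1)‖ * y ^ (j+1)
        ≤ ∑ j ∈ Finset.range M, q * (‖c (j+1)‖ * r0 ^ (j+1)) := by
          refine Finset.sum_le_sum fun j _ => ?_
          calc ‖c (j+1)‖ * y ^ (j+1) ≤ ‖c (j+1)‖ * (r0 * q) ^ (j+1) := by gcongr
            _ = q ^ (j+1) * (‖c (j+1)‖ * r0 ^ (j+1)) := by rw [mul_pow]; ring
            _ ≤ q * (‖c (j+1)‖ * r0 ^ (j+1)) := by
              gcongr
              exact pow_le_of_le_one hqpos.le hq1 (by omega)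
      _ = q * ∑ j ∈ Finset.range M, ‖c (j+1)‖ * r0 ^ (j+1) := by rw [Finset.mul_sum]
      _ ≤ q * T := by
          gcongr
          have h1 : ∑ j ∈ Finset.range (M+1), ‖c j‖ * r0 ^ j ≤ T :=
            hsr0.sum_le_tsum _ fun j _ => by positivity
          rw [Finset.sum_range_succ'] at h1
          have : 0 ≤ ‖c 0‖ * r0 ^ 0 := by positivity
          linarith
      _ ≤ b / 4 := hqT
  have hpair := fun (w : ℂ) => pmc_rem M c r hrpos w
  have hexpS : ∀ w : ℂ, Real.exp (‖w‖ * ∑ j ∈ Finset.range M, ‖c (j+1)‖ * r ^ (j+1)) ≤ Real.exp (‖w‖ * (b/4)) := by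
    intro w
    apply Real.exp_le_exp.2
    gcongr
    exact hsig r hrpos.le le_rfl
  have hev : ∀ ξ : ℝ, 0 ≤ ξ ^ (2*μ) := fun ξ => by rw [pow_mul]; positivity
  have hw : ∀ (n : ℕ) (ξ : ℝ), ‖(n : ℂ) * (Complex.I * ξ) ^ (2*μ)‖ = n * ξ ^ (2*μ) := by
    intro n ξ
    rw [norm_mul, norm_pow, norm_mul, Complex.norm_I, one_mul, Complex.norm_real, Complex.norm_natCast,
      Real.norm_eq_abs, pow_mul, sq_abs, ← pow_mul]
  have hgau : ∀ (n : ℕ) (ξ : ℝ), ‖gau μ (n * β) ξ‖ = Real.exp (- b * (n * ξ ^ (2*μ))) := by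
    intro n ξ
    rw [norm_gau, ← Complex.ofReal_natCast, Complex.re_ofReal_mul]
    congr 1; ring
  refine ⟨r, hrpos, by linarith, 4 / b * (T / r0 ^ (M+1)) + 1 / r ^ (M+1), by positivity, ?_, ?_⟩
  · intro n ξ hξ
    have hξρ : ‖(ξ : ℂ)‖ < ρ := by rw [Complex.norm_real, Real.norm_eq_abs]; linarith
    obtain ⟨t, ht, hΦ⟩ := hsumc ξ hξρ
    set z : ℂ := Complex.I * ξ with hz
    have hzn : ‖z‖ = |ξ| := by rw [hz, norm_mul, Complex.norm_I, one_mul, Complex.norm_real, Real.norm_eq_abs]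
    set w : ℂ := (n:ℂ) * z ^ (2*μ) with hwdef
    have hwn : ‖w‖ = n * ξ ^ (2*μ) := hw n ξ
    set σ : ℂ := ∑ j ∈ Finset.range M, c (j+1) * z ^ (j+1) with hσ
    set τ : ℂ := t - σ with hτ
    have hσn : ‖σ‖ ≤ b/4 := by
      refine (norm_sum_le _ _).trans (le_trans (le_of_eq ?_) (hsig |ξ| (abs_nonneg _) hξ))
      exact Finset.sum_congr rfl fun j _ => by rw [norm_mul, norm_pow, hzn]
    have hτn : ‖τ‖ ≤ T / r0 ^ (M+1) * |ξ| ^ (M+1) := by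
      have h1 := (hasSum_nat_add_iff' (M+1)).2 ht
      rw [Finset.sum_range_succ', hc0, zero_mul, add_zero] at h1
      have h2 : HasSum (fun j => (|ξ| / r0) ^ (M+1) * (‖c (j + (M+1))‖ * r0 ^ (j + (M+1)))) _ :=
        ((hasSum_nat_add_iff' (M+1)).2 hsr0.hasSum).mul_left _
      have h3 := tsum_of_norm_bounded (f := fun j => c (j + (M+1)) * z ^ (j + (M+1))) h2 (fun j => by
        rw [norm_mul, norm_pow, hzn, div_pow, pow_add r0 j (M+1), pow_add |ξ| j (M+1)]
        have : |ξ| ^ (M+1) / r0 ^ (M+1) * (‖c (j + (M+1))‖ * (r0 ^ j * r0 ^ (M+1))) =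
          ‖c (j + (M+1))‖ * (r0 ^ j * |ξ| ^ (M+1)) := by field_simp
        rw [this]
        gcongr
        exact hξ.trans hrr0)
      rw [h1.tsum_eq] at h3
      refine h3.trans ?_
      have h4 : 0 ≤ ∑ i ∈ Finset.range (M+1), ‖c i‖ * r0 ^ i := Finset.sum_nonneg fun _ _ => by positivity
      calc (|ξ| / r0) ^ (M+1) * (T - ∑ i ∈ Finset.range (M+1), ‖c i‖ * r0 ^ i) ≤ (|ξ| / r0) ^ (M+1) * T := by
            gcongr; linarith
        _ = _ := by rw [div_pow]; ring
    have hτ4 : ‖τ‖ ≤ b / 4 := by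
      refine hτn.trans ?_
      calc T / r0 ^ (M+1) * |ξ| ^ (M+1) = T * (|ξ| / r0) ^ (M+1) := by rw [div_pow]; ring
        _ ≤ T * q := by
          gcongr
          have h5 : |ξ| / r0 ≤ q := by rw [div_le_iff₀ hr0pos]; linarith
          exact (pow_le_pow_left₀ (by positivity) h5 _).trans (pow_le_of_le_one hqpos.le hq1 (by omega))
        _ ≤ b / 4 := by linarith
    have hΦn : Φ ξ ^ n = A ^ n * Complex.exp (Complex.I * α * n * ξ) * (gau μ (n * β) ξ * Complex.exp (w * σ + w * τ)) := by
      rw [hΦ, mul_pow, ← Complex.exp_nat_mul, gau, mul_assoc (A^n), ← Complex.exp_add, ← Complex.exp_add]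
      congr 2
      rw [hτ, hwdef]
      ring
    have hsumker : ∑ m ∈ Finset.range (M+1), ker μ β γ m n ξ = gau μ (n * β) ξ * ∑ m ∈ Finset.range (M+1), pmc c w m * z ^ m := by
      rw [Finset.mul_sum]
      exact Finset.sum_congr rfl fun m _ => by rw [ker]; ring
    have hunit : ‖A ^ n * Complex.exp (Complex.I * α * n * ξ)‖ = 1 := by
      rw [norm_mul, norm_pow, hA, one_pow, one_mul,
        show Complex.I * α * n * ξ = ((α * n * ξ : ℝ) : ℂ) * Complex.I by push_cast; ring]
      exact Complex.norm_exp_ofReal_mul_I _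
    rw [hΦn, hsumker, ← mul_sub, ← mul_sub, norm_mul, hunit, one_mul, norm_mul, hgau, ← hwn]
    have hw0 : 0 ≤ ‖w‖ := norm_nonneg _
    have e1 : ‖Complex.exp (w * σ + w * τ) - ∑ m ∈ Finset.range (M+1), pmc c w m * z ^ m‖ ≤
        (4 / b * (T / r0 ^ (M+1)) + 1 / r ^ (M+1)) * |ξ| ^ (M+1) * Real.exp (3 * b / 4 * ‖w‖) := by
      have f1 : ‖Complex.exp (w * σ + w * τ) - Complex.exp (w * σ)‖ ≤
          4 / b * (T / r0 ^ (M+1)) * |ξ| ^ (M+1) * Real.exp (3 * b / 4 * ‖w‖) := by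
        rw [Complex.exp_add, ← mul_sub_one, norm_mul]
        have g1 : ‖Complex.exp (w * σ)‖ ≤ Real.exp (b/4 * ‖w‖) := by
          refine (Complex.norm_exp_le_exp_norm _).trans (Real.exp_le_exp.2 ?_)
          rw [norm_mul, mul_comm]; gcongr
        have g2 : ‖Complex.exp (w * τ) - 1‖ ≤ ‖w‖ * ‖τ‖ * Real.exp (b/4 * ‖w‖) := by
          refine (norm_exp_sub_one_le' _).trans ?_
          rw [norm_mul]
          have g0 : ‖w‖ * ‖τ‖ ≤ b/4 * ‖w‖ := by rw [mul_comm]; gcongr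
          exact mul_le_mul_of_nonneg_left (Real.exp_le_exp.2 g0) (by positivity)
        have g3 : ‖w‖ ≤ 4 / b * Real.exp (b/4 * ‖w‖) := by
          have := Real.add_one_le_exp (b/4 * ‖w‖)
          calc ‖w‖ = 4 / b * (b/4 * ‖w‖) := by field_simp
            _ ≤ _ := by gcongr; linarith
        calc _ ≤ Real.exp (b/4 * ‖w‖) * ((4 / b * Real.exp (b/4 * ‖w‖)) * (T / r0 ^ (M+1) * |ξ| ^ (M+1)) * Real.exp (b/4 * ‖w‖)) := by
              refine mul_le_mul g1 (g2.trans ?_) (norm_nonneg _) (Real.exp_pos _).le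
              gcongr
          _ = _ := by
              rw [show 3 * b / 4 * ‖w‖ = b/4 * ‖w‖ + b/4 * ‖w‖ + b/4 * ‖w‖ by ring, Real.exp_add, Real.exp_add]
              ring
      have f2 : ‖Complex.exp (w * σ) - ∑ m ∈ Finset.range (M+1), pmc c w m * z ^ m‖ ≤
          1 / r ^ (M+1) * |ξ| ^ (M+1) * Real.exp (3 * b / 4 * ‖w‖) := by
        refine ((hpair w).2 z (by rw [hzn]; exact hξ)).trans ?_
        rw [hzn, div_pow, show |ξ| ^ (M+1) / r ^ (M+1) = 1 / r ^ (M+1) * |ξ| ^ (M+1) by ring]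
        have g0 : ‖w‖ * ∑ j ∈ Finset.range M, ‖c (j+1)‖ * r ^ (j+1) ≤ 3 * b / 4 * ‖w‖ := by
          rw [mul_comm]
          exact mul_le_mul_of_nonneg_right ((hsig r hrpos.le le_rfl).trans (by linarith)) hw0
        exact mul_le_mul_of_nonneg_left (Real.exp_le_exp.2 g0) (by positivity)
      calc _ ≤ ‖Complex.exp (w * σ + w * τ) - Complex.exp (w * σ)‖ + ‖Complex.exp (w * σ) - ∑ m ∈ Finset.range (M+1), pmc c w m * z ^ m‖ := norm_sub_le_norm_sub_add_norm_sub _ _ _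
        _ ≤ _ := by rw [add_mul, add_mul]; exact add_le_add f1 f2
    calc _ ≤ Real.exp (-b * ‖w‖) * ((4 / b * (T / r0 ^ (M+1)) + 1 / r ^ (M+1)) * |ξ| ^ (M+1) * Real.exp (3 * b / 4 * ‖w‖)) := by gcongr
      _ = _ := by
        rw [show -(b/4) * ‖w‖ = -b * ‖w‖ + 3 * b / 4 * ‖w‖ by ring, Real.exp_add]
        ring
  · intro n ξ m hm
    set w : ℂ := (n:ℂ) * (Complex.I * ξ) ^ (2*μ) with hwdef
    have h1 := ((hpair w).1 m hm).trans (hexpS w)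
    have hb' := hw n ξ
    rw [ker, norm_mul, norm_mul, hgau, ← hb', norm_pow, norm_mul Complex.I, Complex.norm_I, one_mul, Complex.norm_real, Real.norm_eq_abs]
    have h2 : ‖pmc c w m‖ ≤ Real.exp (‖w‖ * (b/4)) / r ^ m := by rw [le_div_iff₀ (by positivity)]; exact h1
    have hw0 : 0 ≤ ‖w‖ := norm_nonneg _
    calc _ ≤ Real.exp (‖w‖ * (b/4)) / r ^ m * |ξ| ^ m * Real.exp (-b * ‖w‖) := by gcongr
      _ = (|ξ| / r) ^ m * Real.exp (-(3*b/4) * ‖w‖) := by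
        rw [show -(3*b/4) * ‖w‖ = ‖w‖ * (b/4) + -b * ‖w‖ by ring, Real.exp_add, div_pow]; ring
      _ ≤ _ := by
        gcongr
        nlinarith


/-! ### Part 4 : integrated local expansion -/

lemma local_int (μ : ℕ) (hμ : 1 ≤ μ) (β : ℂ) (hβ : 0 < β.re) (γ : ℕ → ℂ)
    (hγlow : ∀ ν : ℕ, ν < 2 * μ + 1 → γ ν = 0) (A : ℂ) (hA : ‖A‖ = 1) (α : ℝ) (Φ : ℂ → ℂ)
    (hΦc : Continuous (fun ξ : ℝ => Φ ξ))
    (ρ : ℝ) (hρ : 0 < ρ)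
    (hexp : ∀ ξ : ℂ, ‖ξ‖ < ρ → ∃ s : ℂ,
      HasSum (fun ν : ℕ => γ ν * (Complex.I * ξ) ^ ν / (Nat.factorial ν : ℂ)) s ∧
      Φ ξ = A * Complex.exp (Complex.I * α * ξ - β * ξ ^ (2 * μ) + s)) (M : ℕ) :
    ∃ r : ℝ, 0 < r ∧ ∀ δ : ℝ, 0 < δ → ∃ C : ℝ, 0 ≤ C ∧
      ∀ S : Set ℝ, MeasurableSet S → (∀ ξ, |ξ| < δ → ξ ∈ S) → (∀ ξ ∈ S, |ξ| ≤ r) →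
      ∀ n : ℕ, 1 ≤ n → ∀ ℓ : ℤ,
        ‖(1 / (2 * Real.pi : ℂ)) * (∫ ξ in S, Complex.exp (-Complex.I * ℓ * ξ) * Φ ξ ^ n) -
          ∑ m ∈ Finset.range (M+1), A ^ n *
            (((n : ℝ) ^ (-((m : ℝ) + 1) / (2 * (μ : ℝ))) : ℝ) : ℂ) *
            PdiffH μ γ m (Hfun μ β) (((ℓ : ℝ) - α * n) / (n : ℝ) ^ ((1 : ℝ) / (2 * (μ : ℝ))))‖ ≤
        C * (n : ℝ) ^ (-((M : ℝ) + 1) / (2 * (μ : ℝ))) := by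
  obtain ⟨r, hr, hrρ, C0, hC0, hloc, hker⟩ := local_bound μ β hβ γ hγlow A hA α Φ ρ hρ hexp M
  refine ⟨r, hr, fun δ hδ => ?_⟩
  set b := β.re with hb
  have hev : ∀ ξ : ℝ, 0 ≤ ξ ^ (2*μ) := fun ξ => by rw [pow_mul]; positivity
  set C1 : ℝ := ∑ m ∈ Finset.range (M+1), (1 / r) ^ m * (1 / δ) ^ (M + 1 - m) with hC1
  have hC1nn : 0 ≤ C1 := Finset.sum_nonneg fun _ _ => by positivity
  set D : ℝ := Real.exp (b/8) * ((M+1).factorial / (b/8)^(M+1)) with hD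
  have hDnn : 0 ≤ D := by positivity
  set G : ℝ := ∫ ξ : ℝ, Real.exp (-(b/8) * ξ^(2*μ)) with hG
  have hGnn : 0 ≤ G := MeasureTheory.integral_nonneg fun _ => (Real.exp_pos _).le
  have hGint : MeasureTheory.Integrable (fun ξ : ℝ => Real.exp (-(b/8) * ξ^(2*μ))) := by
    have h := (pow_gau_integrable μ hμ ((b/8 : ℝ):ℂ) (by rw [Complex.ofReal_re]; positivity) 0).norm
    refine h.congr (Filter.Eventually.of_forall fun ξ => ?_)
    simp only [pow_zero, one_mul]
    rw [norm_gau, Complex.ofReal_re]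
  refine ⟨(1/(2*Real.pi)) * ((C0 + C1) * D * G), by positivity, ?_⟩
  intro S hS hSδ hSr n hn ℓ
  have hn1 : (1:ℝ) ≤ n := by exact_mod_cast hn
  set N : ℝ := (n:ℝ) ^ ((1:ℝ) / (2 * (μ:ℝ))) with hN
  have hNpos : 0 < N := Real.rpow_pos_of_pos (by linarith) _
  have hNpow : N ^ (2*μ) = n := rpow_inv_pow μ hμ n
  have hscale := rpow_scale μ n M
  have hpt : ∀ ξ : ℝ, ‖S.indicator (fun ξ : ℝ => Φ ξ ^ n) ξ - A ^ n * Complex.exp (Complex.I * α * n * ξ) *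
          ∑ m ∈ Finset.range (M+1), ker μ β γ m n ξ‖ ≤
        (C0 + C1) * D * (N^(M+1))⁻¹ * Real.exp (-(b/8) * ξ^(2*μ)) := by
    intro ξ
    have h1 : ‖S.indicator (fun ξ : ℝ => Φ ξ ^ n) ξ - A ^ n * Complex.exp (Complex.I * α * n * ξ) *
          ∑ m ∈ Finset.range (M+1), ker μ β γ m n ξ‖ ≤
        (C0 + C1) * |ξ|^(M+1) * Real.exp (-(b/4) * (n * ξ ^ (2*μ))) := by
      by_cases hξ : ξ ∈ S
      · rw [Set.indicator_of_mem hξ]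
        refine (hloc n ξ (hSr ξ hξ)).trans ?_
        gcongr
        linarith
      · rw [Set.indicator_of_notMem hξ, zero_sub, norm_neg, norm_mul]
        have hunit : ‖A ^ n * Complex.exp (Complex.I * α * n * ξ)‖ = 1 := by
          rw [norm_mul, norm_pow, hA, one_pow, one_mul,
            show Complex.I * α * n * ξ = ((α * n * ξ : ℝ) : ℂ) * Complex.I by push_cast; ring]
          exact Complex.norm_exp_ofReal_mul_I _
        have hδξ : δ ≤ |ξ| := by
          by_contra h
          exact hξ (hSδ ξ (not_le.1 h))
        rw [hunit, one_mul]
        have h2 : ‖∑ m ∈ Finset.range (M+1), ker μ β γ m n ξ‖ ≤ C1 * |ξ|^(M+1) * Real.exp (-(b/4) * (n * ξ ^ (2*μ))) := by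
          refine (norm_sum_le _ _).trans ?_
          rw [hC1, Finset.sum_mul, Finset.sum_mul]
          refine Finset.sum_le_sum fun m hm => ?_
          have hm' : m ≤ M := by have := Finset.mem_range.1 hm; omega
          refine (hker n ξ m hm').trans ?_
          gcongr
          have h3 : (1:ℝ) ≤ (1/δ * |ξ|)^(M+1-m) := by
            apply one_le_pow₀
            rw [one_div_mul_eq_div, le_div_iff₀ hδ]; linarith
          calc (|ξ|/r)^m ≤ (|ξ|/r)^m * (1/δ * |ξ|)^(M+1-m) := le_mul_of_one_le_right (by positivity) h3
            _ = (1/r)^m * (1/δ)^(M+1-m) * (|ξ|^m * |ξ|^(M+1-m)) := by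
                rw [div_eq_mul_one_div, mul_pow, mul_pow]; ring
            _ = _ := by rw [← pow_add, show m + (M+1-m) = M+1 by omega]
        refine h2.trans ?_
        gcongr
        linarith
    refine h1.trans ?_
    have h4 := abs_pow_mul_gauss_le μ hμ (b/8) (by positivity) (M+1) (N*ξ)
    rw [mul_pow, hNpow, abs_mul, abs_of_pos hNpos, mul_pow] at h4
    have h5 : Real.exp (-(b/8) * (n * ξ^(2*μ))) ≤ Real.exp (-(b/8) * ξ^(2*μ)) := by
      apply Real.exp_le_exp.2
      have : ξ^(2*μ) ≤ n * ξ^(2*μ) := le_mul_of_one_le_left (hev ξ) hn1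
      have hb8 : 0 < b/8 := by positivity
      nlinarith
    calc (C0 + C1) * |ξ|^(M+1) * Real.exp (-(b/4) * (n * ξ ^ (2*μ)))
        = (C0+C1) * (N^(M+1))⁻¹ * ((N^(M+1) * |ξ|^(M+1)) * Real.exp (-(b/8) * (n * ξ^(2*μ)))) * Real.exp (-(b/8) * (n * ξ^(2*μ))) := by
          rw [show -(b/4) * (n * ξ ^ (2*μ)) = -(b/8) * (n * ξ^(2*μ)) + -(b/8) * (n * ξ^(2*μ)) by ring, Real.exp_add]
          field_simp
      _ ≤ (C0+C1) * (N^(M+1))⁻¹ * D * Real.exp (-(b/8) * ξ^(2*μ)) := by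
          gcongr
      _ = _ := by ring
  -- assemble
  set y : ℝ := (ℓ:ℝ) - α * n with hy
  have hint1 : MeasureTheory.Integrable (fun ξ : ℝ => Complex.exp (-Complex.I * ℓ * ξ) * S.indicator (fun ξ : ℝ => Φ ξ ^ n) ξ) := by
    have hb : S ⊆ Set.Icc (-r) r := fun ξ hξ => abs_le.1 (hSr ξ hξ)
    have hcont : Continuous (fun ξ : ℝ => Complex.exp (-Complex.I * ℓ * ξ) * Φ ξ ^ n) := 
      (show Continuous (fun ξ : ℝ => Complex.exp (-Complex.I * ℓ * ξ)) by fun_prop).mul (hΦc.pow n)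
    have h6 : MeasureTheory.IntegrableOn (fun ξ : ℝ => Complex.exp (-Complex.I * ℓ * ξ) * Φ ξ ^ n) S :=
      (hcont.continuousOn.integrableOn_compact isCompact_Icc).mono_set hb
    have h7 := h6.integrable_indicator hS
    refine h7.congr (Filter.Eventually.of_forall fun ξ => ?_)
    by_cases hξ : ξ ∈ S <;> simp [hξ]
  have hint2 : ∀ m, MeasureTheory.Integrable (fun ξ : ℝ => Complex.exp (-Complex.I * y * ξ) * ker μ β γ m n ξ) := by
    intro m
    refine (ker_sum_integrable μ hμ β hβ γ m n hn).bdd_mul (c := 1) (by fun_prop) (Filter.Eventually.of_forall fun ξ => ?_)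
    rw [show -Complex.I * y * ξ = ((-(y * ξ) : ℝ) : ℂ) * Complex.I by push_cast; ring]
    exact (Complex.norm_exp_ofReal_mul_I _).le
  have hS1 : (∫ ξ in S, Complex.exp (-Complex.I * ℓ * ξ) * Φ ξ ^ n) =
      ∫ ξ : ℝ, Complex.exp (-Complex.I * ℓ * ξ) * S.indicator (fun ξ : ℝ => Φ ξ ^ n) ξ := by
    rw [← MeasureTheory.integral_indicator hS]
    congr 1
    funext ξ
    by_cases hξ : ξ ∈ S <;> simp [hξ]
  have hS2 : ∑ m ∈ Finset.range (M+1), A ^ n *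
            (((n : ℝ) ^ (-((m : ℝ) + 1) / (2 * (μ : ℝ))) : ℝ) : ℂ) *
            PdiffH μ γ m (Hfun μ β) (y / N) =
      (1 / (2 * Real.pi : ℂ)) * ∫ ξ : ℝ, A^n * ∑ m ∈ Finset.range (M+1), Complex.exp (-Complex.I * y * ξ) * ker μ β γ m n ξ := by
    rw [MeasureTheory.integral_const_mul, MeasureTheory.integral_finsetSum _ (fun m _ => hint2 m), Finset.mul_sum, Finset.mul_sum]
    refine Finset.sum_congr rfl fun m _ => ?_
    rw [mul_assoc, scaled_PdiffH μ hμ β hβ γ m n hn y]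
    ring
  rw [hS1, hS2, ← mul_sub, ← MeasureTheory.integral_sub hint1 ((MeasureTheory.integrable_finsetSum _ fun m _ => hint2 m).const_mul _), norm_mul]
  have hpi : ‖(1 / (2 * Real.pi : ℂ))‖ = 1/(2*Real.pi) := by
    rw [show (1 / (2 * Real.pi : ℂ)) = ((1/(2*Real.pi) : ℝ) : ℂ) by push_cast; rfl, Complex.norm_real, Real.norm_eq_abs, abs_of_pos (by positivity)]
  rw [hpi, hscale, mul_assoc]
  gcongr
  have h8 := MeasureTheory.norm_integral_le_of_norm_le (μ := MeasureTheory.volume)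
    (f := fun ξ : ℝ => Complex.exp (-Complex.I * ℓ * ξ) * S.indicator (fun ξ : ℝ => Φ ξ ^ n) ξ - A^n * ∑ m ∈ Finset.range (M+1), Complex.exp (-Complex.I * y * ξ) * ker μ β γ m n ξ)
    (hGint.const_mul ((C0 + C1) * D * (N^(M+1))⁻¹)) (Filter.Eventually.of_forall fun ξ => by
      have e : Complex.exp (-Complex.I * ℓ * ξ) * S.indicator (fun ξ : ℝ => Φ ξ ^ n) ξ - A^n * ∑ m ∈ Finset.range (M+1), Complex.exp (-Complex.I * y * ξ) * ker μ β γ m n ξ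
        = Complex.exp (-Complex.I * ℓ * ξ) * (S.indicator (fun ξ : ℝ => Φ ξ ^ n) ξ - A ^ n * Complex.exp (Complex.I * α * n * ξ) *
          ∑ m ∈ Finset.range (M+1), ker μ β γ m n ξ) := by
        rw [← Finset.mul_sum, mul_sub]
        congr 1
        rw [show -Complex.I * y * ξ = -Complex.I * ℓ * ξ + Complex.I * α * n * ξ by rw [hy]; push_cast; ring, Complex.exp_add]
        ring
      rw [e, norm_mul, show -Complex.I * ℓ * ξ = ((-(ℓ * ξ) : ℝ) : ℂ) * Complex.I by push_cast; ring, Complex.norm_exp_ofReal_mul_I, one_mul]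
      exact hpt ξ)
  rw [MeasureTheory.integral_const_mul] at h8
  refine h8.trans (le_of_eq ?_)
  rw [hN]; ring


/-! ### Part 5 : Fourier representation of the iterated convolution -/

lemma exp_I_norm_one (x : ℝ) : ‖Complex.exp (Complex.I * x)‖ = 1 := by
  rw [mul_comm]; exact Complex.norm_exp_ofReal_mul_I x

lemma fourier_cont (a : ℤ → ℂ) (ha : Summable fun ℓ : ℤ => ‖a ℓ‖) (f : ℝ → ℂ)
    (hf : ∀ θ : ℝ, HasSum (fun ℓ : ℤ => a ℓ * Complex.exp (Complex.I * ((ℓ * θ : ℝ) : ℂ))) (f θ)) :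
    Continuous f := by
  have : f = fun θ => ∑' ℓ : ℤ, a ℓ * Complex.exp (Complex.I * ((ℓ * θ : ℝ) : ℂ)) := by
    funext θ; exact (hf θ).tsum_eq.symm
  rw [this]
  refine continuous_tsum (fun ℓ => by fun_prop) ha fun ℓ θ => ?_
  rw [norm_mul, exp_I_norm_one, mul_one]

lemma fourier_swap (a : ℤ → ℂ) (ha : Summable fun ℓ : ℤ => ‖a ℓ‖) (f : ℝ → ℂ)
    (hf : ∀ θ : ℝ, HasSum (fun ℓ : ℤ => a ℓ * Complex.exp (Complex.I * ((ℓ * θ : ℝ) : ℂ))) (f θ))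
    (G : ℝ → ℂ) (hG : Continuous G) :
    HasSum (fun j : ℤ => ∫ θ in (-Real.pi)..Real.pi, a j * Complex.exp (Complex.I * ((j * θ : ℝ) : ℂ)) * G θ)
      (∫ θ in (-Real.pi)..Real.pi, f θ * G θ) := by
  refine intervalIntegral.hasSum_integral_of_dominated_convergence (fun j θ => ‖a j‖ * ‖G θ‖) ?_ ?_ ?_ ?_ ?_
  · intro j
    exact Continuous.aestronglyMeasurable (by fun_prop)
  · intro j
    refine Filter.Eventually.of_forall fun θ _ => ?_
    rw [norm_mul, norm_mul, exp_I_norm_one, mul_one]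
  · exact Filter.Eventually.of_forall fun θ _ => ha.mul_right _
  · have : (fun θ => ∑' j, ‖a j‖ * ‖G θ‖) = fun θ => (∑' j, ‖a j‖) * ‖G θ‖ := by
      funext θ; rw [tsum_mul_right]
    rw [this]
    exact Continuous.intervalIntegrable (by fun_prop) _ _
  · exact Filter.Eventually.of_forall fun θ _ => (hf θ).mul_right _

lemma fourier_orth (k : ℤ) : (∫ θ in (-Real.pi)..Real.pi, Complex.exp (Complex.I * ((k * θ : ℝ) : ℂ))) =
    if k = 0 then (2 * Real.pi : ℂ) else 0 := by
  split_ifs with h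
  · subst h; simp; ring
  · have hc : (Complex.I * k) ≠ 0 := mul_ne_zero Complex.I_ne_zero (by exact_mod_cast h)
    have := integral_exp_mul_complex (a := -Real.pi) (b := Real.pi) hc
    have e : ∀ θ : ℝ, Complex.I * ((k * θ : ℝ) : ℂ) = Complex.I * k * θ := fun θ => by push_cast; ring
    simp only [e]
    rw [this]
    have e2 : Complex.exp (Complex.I * k * (Real.pi : ℝ)) = Complex.exp (Complex.I * k * ((-Real.pi : ℝ) : ℂ)) := by
      rw [Complex.exp_eq_exp_iff_exists_int]
      exact ⟨k, by push_cast; ring⟩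
    rw [e2, sub_self, zero_div]

lemma fourier_rep (a : ℤ → ℂ) (ha : Summable fun ℓ : ℤ => ‖a ℓ‖) (f : ℝ → ℂ)
    (hf : ∀ θ : ℝ, HasSum (fun ℓ : ℤ => a ℓ * Complex.exp (Complex.I * ((ℓ * θ : ℝ) : ℂ))) (f θ))
    (n : ℕ) : ∀ ℓ : ℤ, iterConv a n ℓ = (1 / (2 * Real.pi : ℂ)) *
      ∫ θ in (-Real.pi)..Real.pi, Complex.exp (-Complex.I * ℓ * θ) * f θ ^ (n+1) := by
  have hfc := fourier_cont a ha f hf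
  have hpi : (2 * Real.pi : ℂ) ≠ 0 := by
    have := Real.pi_ne_zero
    exact mul_ne_zero two_ne_zero (by exact_mod_cast this)
  induction n with
  | zero =>
    intro ℓ
    have h := fourier_swap a ha f hf (fun θ => Complex.exp (-Complex.I * ℓ * θ)) (by fun_prop)
    have e : (fun j : ℤ => ∫ θ in (-Real.pi)..Real.pi, a j * Complex.exp (Complex.I * ((j * θ : ℝ) : ℂ)) * Complex.exp (-Complex.I * ℓ * θ))
        = fun j : ℤ => if j = ℓ then a ℓ * (2 * Real.pi : ℂ) else 0 := by
      funext j
      have e1 : ∀ θ : ℝ, a j * Complex.exp (Complex.I * ((j * θ : ℝ) : ℂ)) * Complex.exp (-Complex.I * ℓ * θ) =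
          a j * Complex.exp (Complex.I * ((((j - ℓ : ℤ) : ℝ) * θ : ℝ) : ℂ)) := by
        intro θ
        rw [mul_assoc, ← Complex.exp_add]
        congr 2
        push_cast; ring
      simp only [e1]
      rw [intervalIntegral.integral_const_mul, fourier_orth]
      by_cases hj : j = ℓ
      · simp [hj]
      · simp [hj, sub_eq_zero]
    rw [e] at h
    have h2 := h.unique (hasSum_ite_eq ℓ (a ℓ * (2 * Real.pi : ℂ)))
    have h3 : (∫ θ in (-Real.pi)..Real.pi, Complex.exp (-Complex.I * ℓ * θ) * f θ ^ (0+1)) = a ℓ * (2 * Real.pi : ℂ) := by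
      rw [← h2]
      congr 1
      funext θ
      rw [zero_add, pow_one, mul_comm]
    rw [h3, iterConv]
    field_simp
  | succ n ih =>
    intro ℓ
    have hG : Continuous (fun θ : ℝ => Complex.exp (-Complex.I * ℓ * θ) * f θ ^ (n+1)) := by fun_prop
    have h := (fourier_swap a ha f hf _ hG).mul_left (1 / (2 * Real.pi : ℂ))
    have h3 : (∫ θ in (-Real.pi)..Real.pi, Complex.exp (-Complex.I * ℓ * θ) * f θ ^ (n+1+1)) =
        ∫ θ in (-Real.pi)..Real.pi, f θ * (Complex.exp (-Complex.I * ℓ * θ) * f θ ^ (n+1)) := by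
      congr 1
      funext θ
      rw [pow_succ]; ring
    rw [h3, ← h.tsum_eq, iterConv, conv]
    refine tsum_congr fun j => ?_
    rw [ih, mul_assoc, ← intervalIntegral.integral_mul_const]
    congr 2
    funext θ
    have : Complex.exp (-Complex.I * ((ℓ - j : ℤ) : ℂ) * θ) = Complex.exp (Complex.I * ((j * θ : ℝ) : ℂ)) * Complex.exp (-Complex.I * ℓ * θ) := by
      rw [← Complex.exp_add]; congr 1; push_cast; ring
    rw [this]; ring

lemma abs_le_of_exp (ξ : ℝ) (h : |ξ| ≤ Real.pi) : |ξ| ≤ Real.pi / 2 * ‖Complex.exp (Complex.I * ξ) - 1‖ := by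
  rw [Complex.norm_exp_I_mul_ofReal_sub_one]
  have h1 := Real.mul_abs_le_abs_sin (x := ξ/2) (by rw [abs_div, abs_two]; linarith)
  rw [norm_mul, Real.norm_eq_abs, Real.norm_eq_abs, abs_two]
  rw [abs_div, abs_two] at h1
  have hp := Real.pi_pos
  calc |ξ| = Real.pi * (2 / Real.pi * (|ξ|/2)) := by field_simp
    _ ≤ Real.pi * |Real.sin (ξ/2)| := by gcongr
    _ = _ := by ring

lemma geom_bdd_poly (q : ℝ) (hq0 : 0 ≤ q) (hq : q < 1) (s : ℕ) : ∃ C : ℝ, 0 ≤ C ∧ ∀ n : ℕ, (n:ℝ)^s * q^n ≤ C := by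
  obtain ⟨C, hC⟩ := (tendsto_pow_const_mul_const_pow_of_abs_lt_one s (r := q) (by rwa [abs_of_nonneg hq0])).bddAbove_range
  refine ⟨C, le_trans (by positivity) (hC ⟨0, rfl⟩), fun n => hC ⟨n, rfl⟩⟩


/-! ### Part 6 : uniform bound -/

lemma circle_hasSum (a : ℤ → ℂ) (ε : ℝ) (hε : 0 < ε) (F : ℂ → ℂ)
    (hFsum : ∀ ζ : ℂ, 1 - ε < ‖ζ‖ → ‖ζ‖ < 1 + ε → HasSum (fun ℓ : ℤ => a ℓ * ζ ^ ℓ) (F ζ)) (θ : ℝ) :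
    HasSum (fun ℓ : ℤ => a ℓ * Complex.exp (Complex.I * ((ℓ * θ : ℝ) : ℂ))) (F (Complex.exp (Complex.I * θ))) := by
  have h := hFsum (Complex.exp (Complex.I * θ)) (by rw [exp_I_norm_one]; linarith) (by rw [exp_I_norm_one]; linarith)
  refine h.congr_fun fun ℓ => ?_
  rw [← Complex.exp_int_mul]
  congr 2
  push_cast; ring

lemma rpow_neg_mono (n : ℕ) (hn : 1 ≤ n) (s : ℝ) (hs : 0 ≤ s) (x y : ℕ) (hx : 1 ≤ x) (hxy : x ≤ y) :
    (n:ℝ) ^ (-s / (2 * (x:ℝ))) ≤ (n:ℝ) ^ (-s / (2 * (y:ℝ))) := by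
  apply Real.rpow_le_rpow_of_exponent_le (by exact_mod_cast hn)
  rw [neg_div, neg_div, neg_le_neg_iff]
  have h1 : (1:ℝ) ≤ x := by exact_mod_cast hx
  have h2 : (x:ℝ) ≤ y := by exact_mod_cast hxy
  gcongr

lemma arc_integral (f : ℝ → ℂ) (hper : Function.Periodic f (2 * Real.pi))
    (θ₀ δ : ℝ) (n : ℕ) (ℓ : ℤ) :
    (∫ θ in (-Real.pi)..Real.pi, {θ : ℝ | ‖Complex.exp (Complex.I * θ) - Complex.exp (Complex.I * θ₀)‖ < δ}.indicator
      (fun θ : ℝ => Complex.exp (-Complex.I * ℓ * θ) * f θ ^ n) θ) =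
    Complex.exp (Complex.I * θ₀) ^ (-ℓ) *
      ∫ ξ in {ξ : ℝ | ξ ∈ Set.Ioc (-Real.pi) Real.pi ∧ ‖Complex.exp (Complex.I * ξ) - 1‖ < δ},
        Complex.exp (-Complex.I * ℓ * ξ) * f (θ₀ + ξ) ^ n := by
  set U := {θ : ℝ | ‖Complex.exp (Complex.I * θ) - Complex.exp (Complex.I * θ₀)‖ < δ} with hU
  set g := U.indicator (fun θ : ℝ => Complex.exp (-Complex.I * ℓ * θ) * f θ ^ n) with hg
  have hexpper : ∀ θ : ℝ, Complex.exp (Complex.I * ((θ + 2 * Real.pi : ℝ) : ℂ)) = Complex.exp (Complex.I * θ) := by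
    intro θ
    rw [Complex.exp_eq_exp_iff_exists_int]
    exact ⟨1, by push_cast; ring⟩
  have hgper : Function.Periodic g (2 * Real.pi) := by
    intro θ
    have e1 : (θ + 2 * Real.pi ∈ U) ↔ θ ∈ U := by
      simp only [hU, Set.mem_ofPred_eq, hexpper]
    have e2 : Complex.exp (-Complex.I * ℓ * ((θ + 2 * Real.pi : ℝ):ℂ)) = Complex.exp (-Complex.I * ℓ * θ) := by
      rw [Complex.exp_eq_exp_iff_exists_int]
      exact ⟨-ℓ, by push_cast; ring⟩
    by_cases h : θ ∈ U
    · rw [hg, Set.indicator_of_mem h, Set.indicator_of_mem (e1.2 h), e2, hper]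
    · rw [hg, Set.indicator_of_notMem h, Set.indicator_of_notMem (fun h' => h (e1.1 h'))]
  have h1 := hgper.intervalIntegral_add_eq (-Real.pi) (θ₀ - Real.pi)
  rw [show -Real.pi + 2 * Real.pi = Real.pi by ring, show θ₀ - Real.pi + 2 * Real.pi = θ₀ + Real.pi by ring] at h1
  have h2 : (∫ x in (θ₀ - Real.pi)..(θ₀ + Real.pi), g x) = ∫ ξ in (-Real.pi)..Real.pi, g (θ₀ + ξ) := by
    rw [intervalIntegral.integral_comp_add_left, sub_eq_add_neg]
  have hmeas : MeasurableSet {ξ : ℝ | ‖Complex.exp (Complex.I * ξ) - 1‖ < δ} :=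
    (isOpen_lt (by fun_prop) continuous_const).measurableSet
  have hset : {ξ : ℝ | ξ ∈ Set.Ioc (-Real.pi) Real.pi ∧ ‖Complex.exp (Complex.I * ξ) - 1‖ < δ} =
      Set.Ioc (-Real.pi) Real.pi ∩ {ξ : ℝ | ‖Complex.exp (Complex.I * ξ) - 1‖ < δ} := rfl
  rw [h1, h2, intervalIntegral.integral_of_le (by linarith [Real.pi_pos]), hset, ← MeasureTheory.setIntegral_indicator hmeas,
    ← MeasureTheory.integral_const_mul]
  congr 1
  funext ξ
  have e3 : (θ₀ + ξ ∈ U) ↔ ξ ∈ {ξ : ℝ | ‖Complex.exp (Complex.I * ξ) - 1‖ < δ} := by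
    simp only [hU, Set.mem_ofPred_eq]
    rw [Complex.ofReal_add, mul_add, Complex.exp_add, ← mul_sub_one, norm_mul, exp_I_norm_one, one_mul]
  by_cases h : θ₀ + ξ ∈ U
  · rw [hg, Set.indicator_of_mem h, Set.indicator_of_mem (e3.1 h), ← Complex.exp_int_mul, ← mul_assoc, ← Complex.exp_add]
    congr 2
    push_cast; ring
  · rw [hg, Set.indicator_of_notMem h, Set.indicator_of_notMem (fun h' => h (e3.2 h')), mul_zero]

lemma sup_bound
    (a : ℤ → ℂ) (ha : Summable fun ℓ : ℤ => ‖a ℓ‖)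
    (ε : ℝ) (hε : 0 < ε) (F : ℂ → ℂ)
    (hFsum : ∀ ζ : ℂ, 1 - ε < ‖ζ‖ → ‖ζ‖ < 1 + ε →
      HasSum (fun ℓ : ℤ => a ℓ * ζ ^ ℓ) (F ζ))
    (K : ℕ) (κ : Fin K → ℂ) (hκinj : Function.Injective κ)
    (hκmod : ∀ k, ‖κ k‖ = 1)
    (hκtang : ∀ k, ‖F (κ k)‖ = 1)
    (hlt : ∀ z : ℂ, ‖z‖ = 1 → (∀ k, z ≠ κ k) → ‖F z‖ < 1)
    (α : Fin K → ℝ) (β : Fin K → ℂ) (hβ : ∀ k, 0 < (β k).re)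
    (μ : Fin K → ℕ) (hμ : ∀ k, 1 ≤ μ k) (hK : 1 ≤ K)
    (γ : Fin K → ℕ → ℂ) (hγlow : ∀ k, ∀ ν : ℕ, ν < 2 * μ k + 1 → γ k ν = 0)
    (hexp : ∀ k, ∃ ρ : ℝ, 0 < ρ ∧ ∀ ξ : ℂ, ‖ξ‖ < ρ → ∃ s : ℂ,
      HasSum (fun ν : ℕ => γ k ν * (Complex.I * ξ) ^ ν / (Nat.factorial ν : ℂ)) s ∧
      F (κ k * Complex.exp (Complex.I * ξ)) =
        F (κ k) * Complex.exp (Complex.I * (α k) * ξ - β k * ξ ^ (2 * μ k) + s))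
    (v : ℕ → Fin K → ℕ → ℤ → ℂ)
    (hv : ∀ n k m, v n k m = fun ℓ : ℤ =>
      κ k ^ (-ℓ) * F (κ k) ^ n *
        (((n : ℝ) ^ (-((m : ℝ) + 1) / (2 * (μ k : ℝ))) : ℝ) : ℂ) *
        PdiffH (μ k) (γ k) m (Hfun (μ k) (β k))
          (((ℓ : ℝ) - α k * n) / (n : ℝ) ^ ((1 : ℝ) / (2 * (μ k : ℝ))))) (M : ℕ) :
    ∃ C : ℝ, 0 ≤ C ∧ ∀ n : ℕ, 1 ≤ n → ∀ ℓ : ℤ,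
      ‖iterConv a (n-1) ℓ - ∑ k : Fin K, ∑ m ∈ Finset.range (M+1), v n k m ℓ‖ ≤
        C * (n : ℝ) ^ (-((M : ℝ) + 1) / (2 * ((Finset.univ.sup μ : ℕ) : ℝ))) := by
  set f : ℝ → ℂ := fun θ => F (Complex.exp (Complex.I * θ)) with hf
  have hfs := circle_hasSum a ε hε F hFsum
  have hfc : Continuous f := fourier_cont a ha f hfs
  have hrep := fourier_rep a ha f hfs
  have hper : Function.Periodic f (2 * Real.pi) := by
    intro θ
    simp only [hf]
    congr 1
    rw [Complex.exp_eq_exp_iff_exists_int]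
    exact ⟨1, by push_cast; ring⟩
  -- arguments of the tangency points
  choose θ₀ hθ₀ using fun k => (Complex.norm_eq_one_iff (κ k)).1 (hκmod k)
  have hθ : ∀ k, κ k = Complex.exp (Complex.I * θ₀ k) := fun k => by rw [mul_comm]; exact (hθ₀ k).symm
  choose ρ hρ hexp' using hexp
  have hshift : ∀ k, ∀ ξ : ℝ, F (κ k * Complex.exp (Complex.I * ξ)) = f (θ₀ k + ξ) := by
    intro k ξ
    simp only [hf]
    rw [hθ k, ← Complex.exp_add]; congr 2; push_cast; ring
  have hloc := fun k => local_int (μ k) (hμ k) (β k) (hβ k) (γ k) (hγlow k) (F (κ k)) (hκtang k) (α k)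
    (fun ξ => F (κ k * Complex.exp (Complex.I * ξ)))
    (by simp only [hshift]; fun_prop) (ρ k) (hρ k) (hexp' k) M
  choose r hr hloc' using hloc
  -- choice of delta
  obtain ⟨δ, hδ, hδπ, hδr, hδsep⟩ : ∃ δ : ℝ, 0 < δ ∧ δ ≤ Real.pi ∧ (∀ k, Real.pi / 2 * δ ≤ r k) ∧
      (∀ k k', k ≠ k' → 2 * δ ≤ ‖κ k - κ k'‖) := by
    have e1 : ∀ᶠ δ : ℝ in nhdsWithin 0 (Set.Ioi 0), δ ≤ Real.pi :=
      (nhdsWithin_le_nhds (Iic_mem_nhds Real.pi_pos))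
    have e2 : ∀ᶠ δ : ℝ in nhdsWithin 0 (Set.Ioi 0), ∀ k, Real.pi / 2 * δ ≤ r k := by
      rw [Filter.eventually_all]
      intro k
      have h : Filter.Tendsto (fun δ : ℝ => Real.pi / 2 * δ) (nhds 0) (nhds (Real.pi / 2 * 0)) :=
        (continuous_const.mul continuous_id).tendsto 0
      rw [mul_zero] at h
      exact nhdsWithin_le_nhds (h (Iic_mem_nhds (hr k)))
    have e3 : ∀ᶠ δ : ℝ in nhdsWithin 0 (Set.Ioi 0), ∀ k k', k ≠ k' → 2 * δ ≤ ‖κ k - κ k'‖ := by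
      rw [Filter.eventually_all]
      intro k
      rw [Filter.eventually_all]
      intro k'
      by_cases hkk : k = k'
      · exact Filter.Eventually.of_forall fun δ h => absurd hkk h
      have h : Filter.Tendsto (fun δ : ℝ => 2 * δ) (nhds 0) (nhds (2 * 0)) :=
        (continuous_const.mul continuous_id).tendsto 0
      rw [mul_zero] at h
      have hpos : 0 < ‖κ k - κ k'‖ := norm_pos_iff.2 (sub_ne_zero.2 fun h => hkk (hκinj h))
      have h5 : ∀ᶠ δ : ℝ in nhds 0, 2 * δ ≤ ‖κ k - κ k'‖ := h (Iic_mem_nhds hpos)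
      exact nhdsWithin_le_nhds (h5.mono fun δ h _ => h)
    have e4 : ∀ᶠ δ : ℝ in nhdsWithin 0 (Set.Ioi 0), 0 < δ := self_mem_nhdsWithin
    obtain ⟨δ, h1, h2, h3, h4⟩ := (e4.and (e1.and (e2.and e3))).exists
    exact ⟨δ, h1, h2, h3, h4⟩
  -- away from the tangency points
  obtain ⟨q, hq0, hq1, hq⟩ : ∃ q : ℝ, 0 ≤ q ∧ q < 1 ∧ ∀ θ : ℝ,
      (∀ k, δ ≤ ‖Complex.exp (Complex.I * θ) - κ k‖) → ‖f θ‖ ≤ q := by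
    set T : Set ℝ := Set.Icc (-Real.pi) Real.pi ∩ {θ : ℝ | ∀ k, δ ≤ ‖Complex.exp (Complex.I * θ) - κ k‖} with hT
    have hclosed : IsClosed {θ : ℝ | ∀ k, δ ≤ ‖Complex.exp (Complex.I * θ) - κ k‖} := by
      rw [Set.ofPred_forall]
      exact isClosed_iInter fun k => isClosed_le continuous_const (by fun_prop)
    have hTc : IsCompact T := isCompact_Icc.inter_right hclosed
    have hred : ∀ θ : ℝ, (∀ k, δ ≤ ‖Complex.exp (Complex.I * θ) - κ k‖) → ∃ θ' ∈ T, f θ' = f θ := by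
      intro θ h
      have hn : ‖Complex.exp (Complex.I * θ)‖ = 1 := exp_I_norm_one θ
      refine ⟨Complex.arg (Complex.exp (Complex.I * θ)), ?_, ?_⟩
      · have e : Complex.exp (Complex.I * (Complex.arg (Complex.exp (Complex.I * θ)) : ℝ)) = Complex.exp (Complex.I * θ) := by
          have := Complex.norm_mul_exp_arg_mul_I (Complex.exp (Complex.I * θ))
          rw [hn, Complex.ofReal_one, one_mul] at this
          rw [mul_comm Complex.I]; exact this
        refine ⟨⟨(Complex.neg_pi_lt_arg _).le, Complex.arg_le_pi _⟩, ?_⟩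
        intro k
        rw [e]; exact h k
      · have e : Complex.exp (Complex.I * (Complex.arg (Complex.exp (Complex.I * θ)) : ℝ)) = Complex.exp (Complex.I * θ) := by
          have := Complex.norm_mul_exp_arg_mul_I (Complex.exp (Complex.I * θ))
          rw [hn, Complex.ofReal_one, one_mul] at this
          rw [mul_comm Complex.I]; exact this
        simp only [hf]
        rw [e]
    rcases T.eq_empty_or_nonempty with hTe | hTne
    · refine ⟨0, le_rfl, one_pos, fun θ h => ?_⟩
      obtain ⟨θ', h', _⟩ := hred θ h
      rw [hTe] at h'
      exact absurd h' (Set.notMem_empty _)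
    · obtain ⟨x, hx, hmax⟩ := hTc.exists_isMaxOn hTne hfc.norm.continuousOn
      refine ⟨‖f x‖, norm_nonneg _, ?_, fun θ h => ?_⟩
      · refine hlt _ (exp_I_norm_one x) fun k hk => ?_
        have := hx.2 k
        rw [hk, sub_self, norm_zero] at this
        linarith
      · obtain ⟨θ', h', he⟩ := hred θ h
        rw [← he]; exact hmax h'
  obtain ⟨Cq, hCq0, hCq⟩ := geom_bdd_poly q hq0 hq1 (M+1)
  choose C hC0 hC using fun k => hloc' k δ hδ
  set μm := Finset.univ.sup μ with hμm
  have hμle : ∀ k, μ k ≤ μm := fun k => Finset.le_sup (Finset.mem_univ k)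
  have hμm1 : 1 ≤ μm := (hμ ⟨0, hK⟩).trans (hμle _)
  refine ⟨Cq + ∑ k, C k, add_nonneg hCq0 (Finset.sum_nonneg fun k _ => hC0 k), ?_⟩
  intro n hn ℓ
  have hn1 : (1:ℝ) ≤ n := by exact_mod_cast hn
  set R := (n : ℝ) ^ (-((M : ℝ) + 1) / (2 * (μm : ℝ))) with hR
  have hRpos : 0 < R := Real.rpow_pos_of_pos (by linarith) _
  have hi := hrep (n-1) ℓ
  rw [show n - 1 + 1 = n by omega] at hi
  set g : ℝ → ℂ := fun θ : ℝ => Complex.exp (-Complex.I * ℓ * θ) * f θ ^ n with hg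
  have hgc : Continuous g := by fun_prop
  set U : Fin K → Set ℝ := fun k => {θ : ℝ | ‖Complex.exp (Complex.I * θ) - Complex.exp (Complex.I * θ₀ k)‖ < δ} with hU
  have hUm : ∀ k, MeasurableSet (U k) := fun k => (isOpen_lt (by fun_prop) continuous_const).measurableSet
  set rest : ℝ → ℂ := fun θ => g θ - ∑ k, (U k).indicator g θ with hrest
  have hrestb : ∀ θ, ‖rest θ‖ ≤ q ^ n := by
    intro θ
    by_cases h : ∃ k, θ ∈ U k
    · obtain ⟨k, hk⟩ := h
      have : ∑ k', (U k').indicator g θ = g θ := by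
        rw [Finset.sum_eq_single k]
        · exact Set.indicator_of_mem hk _
        · intro k' _ hne
          refine Set.indicator_of_notMem (fun hk' => ?_) _
          simp only [hU, Set.mem_ofPred_eq, ← hθ] at hk hk'
          have h1 := hδsep k' k hne
          have h2 : ‖κ k' - κ k‖ ≤ ‖Complex.exp (Complex.I * θ) - κ k‖ + ‖Complex.exp (Complex.I * θ) - κ k'‖ := by
            rw [show κ k' - κ k = (Complex.exp (Complex.I * θ) - κ k) - (Complex.exp (Complex.I * θ) - κ k') by ring]
            exact norm_sub_le _ _
          linarith
        · simp
      simp only [hrest, this, sub_self, norm_zero]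
      positivity
    · push Not at h
      have : ∑ k', (U k').indicator g θ = 0 := Finset.sum_eq_zero fun k _ => Set.indicator_of_notMem (h k) _
      have er : rest θ = Complex.exp (-Complex.I * ℓ * θ) * f θ ^ n := by
        simp only [hrest, this, sub_zero]
        rfl
      rw [er, norm_mul, show -Complex.I * ℓ * θ = Complex.I * ((-(ℓ * θ) : ℝ) : ℂ) by push_cast; ring, exp_I_norm_one, one_mul, norm_pow]
      refine pow_le_pow_left₀ (norm_nonneg _) (hq θ fun k => ?_) n
      have := h k
      simp only [hU, Set.mem_ofPred_eq, ← hθ, not_lt] at this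
      exact this
  have hIntg : ∀ k, IntervalIntegrable ((U k).indicator g) MeasureTheory.volume (-Real.pi) Real.pi := by
    intro k
    have := hgc.intervalIntegrable (μ := MeasureTheory.volume) (-Real.pi) Real.pi
    rw [intervalIntegrable_iff] at this ⊢
    exact this.indicator (hUm k)
  have hsplit : (∫ θ in (-Real.pi)..Real.pi, g θ) = (∫ θ in (-Real.pi)..Real.pi, rest θ) +
      ∑ k, ∫ θ in (-Real.pi)..Real.pi, (U k).indicator g θ := by
    have hsi : IntervalIntegrable (fun θ => ∑ k, (U k).indicator g θ) MeasureTheory.volume (-Real.pi) Real.pi := by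
      have := IntervalIntegrable.sum (μ := MeasureTheory.volume) (a := -Real.pi) (b := Real.pi) Finset.univ (f := fun k => (U k).indicator g) fun k _ => hIntg k
      refine this.congr ?_
      intro θ _
      simp
    rw [← intervalIntegral.integral_finsetSum fun k _ => hIntg k, ← intervalIntegral.integral_add ((hgc.intervalIntegrable _ _).sub hsi) hsi]
    congr 1
    funext θ
    simp
  have hrestint : ‖∫ θ in (-Real.pi)..Real.pi, rest θ‖ ≤ q ^ n * (2 * Real.pi) := by
    have := intervalIntegral.norm_integral_le_of_norm_le_const (a := -Real.pi) (b := Real.pi) (f := rest) (C := q^n) fun θ _ => hrestb θ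
    rw [show Real.pi - -Real.pi = 2 * Real.pi by ring, abs_of_pos (by positivity)] at this
    exact this
  have hpi : ‖(1 / (2 * Real.pi : ℂ))‖ = 1/(2*Real.pi) := by
    rw [show (1 / (2 * Real.pi : ℂ)) = ((1/(2*Real.pi) : ℝ) : ℂ) by push_cast; rfl, Complex.norm_real, Real.norm_eq_abs, abs_of_pos (by positivity)]
  have hqR : q ^ n ≤ Cq * R := by
    have h1 := hCq n
    have h2 : ((n:ℝ)^(M+1))⁻¹ ≤ R := by
      rw [hR, ← Real.rpow_natCast, ← Real.rpow_neg (by linarith)]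
      apply Real.rpow_le_rpow_of_exponent_le hn1
      rw [neg_div, neg_le_neg_iff]
      push_cast
      have : (1:ℝ) ≤ μm := by exact_mod_cast hμm1
      apply div_le_self (by positivity) (by linarith)
    calc q ^ n = ((n:ℝ)^(M+1) * q^n) * ((n:ℝ)^(M+1))⁻¹ := by field_simp
      _ ≤ Cq * R := by gcongr
  have hk : ∀ k, ‖(1 / (2 * Real.pi : ℂ)) * (∫ θ in (-Real.pi)..Real.pi, (U k).indicator g θ) -
      ∑ m ∈ Finset.range (M+1), v n k m ℓ‖ ≤ C k * R := by
    intro k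
    have hSm : MeasurableSet {ξ : ℝ | ξ ∈ Set.Ioc (-Real.pi) Real.pi ∧ ‖Complex.exp (Complex.I * ξ) - 1‖ < δ} :=
      measurableSet_Ioc.inter (isOpen_lt (f := fun ξ : ℝ => ‖Complex.exp (Complex.I * ξ) - 1‖) (by fun_prop) continuous_const).measurableSet
    have h1 := hC k _ hSm (fun ξ hξ => by
      have h2 := abs_lt.1 (hξ.trans_le hδπ)
      exact ⟨⟨h2.1, h2.2.le⟩, lt_of_le_of_lt Real.norm_exp_I_mul_ofReal_sub_one_le hξ⟩) (fun ξ hξ => by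
      have h2 : |ξ| ≤ Real.pi := abs_le.2 ⟨hξ.1.1.le, hξ.1.2⟩
      refine (abs_le_of_exp ξ h2).trans (le_trans ?_ (hδr k))
      have := Real.pi_pos
      have := hξ.2
      gcongr) n hn ℓ
    rw [hU, hg, arc_integral f hper (θ₀ k) δ n ℓ, ← hθ k]
    simp only [hshift] at h1
    have h3 : ∑ m ∈ Finset.range (M+1), v n k m ℓ = κ k ^ (-ℓ) * ∑ m ∈ Finset.range (M+1), F (κ k) ^ n *
            (((n : ℝ) ^ (-((m : ℝ) + 1) / (2 * (μ k : ℝ))) : ℝ) : ℂ) *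
            PdiffH (μ k) (γ k) m (Hfun (μ k) (β k)) (((ℓ : ℝ) - α k * n) / (n : ℝ) ^ ((1 : ℝ) / (2 * (μ k : ℝ)))) := by
      rw [Finset.mul_sum]
      refine Finset.sum_congr rfl fun m _ => ?_
      rw [hv]; ring
    rw [h3, ← mul_assoc, mul_comm (1 / (2 * Real.pi : ℂ)), mul_assoc, ← mul_sub, norm_mul, norm_zpow, hκmod, one_zpow, one_mul]
    refine h1.trans ?_
    have h4 := rpow_neg_mono n hn ((M:ℝ)+1) (by positivity) (μ k) μm (hμ k) (hμle k)
    have := hC0 k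
    gcongr
  rw [hi, hsplit, mul_add, Finset.mul_sum, add_sub_assoc, ← Finset.sum_sub_distrib]
  refine (norm_add_le _ _).trans ?_
  rw [add_mul, Finset.sum_mul]
  refine add_le_add ?_ ((norm_sum_le _ _).trans (Finset.sum_le_sum fun k _ => hk k))
  rw [norm_mul, hpi]
  calc 1 / (2 * Real.pi) * ‖∫ θ in (-Real.pi)..Real.pi, rest θ‖ ≤ 1 / (2 * Real.pi) * (q ^ n * (2 * Real.pi)) := by gcongr
    _ = q ^ n := by field_simp
    _ ≤ _ := hqR


/-! ### Part 7 : tails -/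

lemma iter_tail (a : ℤ → ℂ) (ε : ℝ) (hε : 0 < ε) (F : ℂ → ℂ)
    (hFsum : ∀ ζ : ℂ, 1 - ε < ‖ζ‖ → ‖ζ‖ < 1 + ε → HasSum (fun ℓ : ℤ => a ℓ * ζ ^ ℓ) (F ζ)) :
    ∃ s B : ℝ, 1 < s ∧ 1 ≤ B ∧ ∀ (n : ℕ) (ℓ : ℤ), ‖iterConv a n ℓ‖ * (s ^ ℓ.natAbs) ^ 2 ≤ B ^ (n+1) := by
  set r : ℝ := 1 + ε/2 with hr
  have hr1 : 1 < r := by linarith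
  have hr0 : 0 < r := by linarith
  have hinv : 1 - ε < r⁻¹ := by
    rw [← one_div, lt_div_iff₀ hr0, hr]
    nlinarith
  have s1 := (hFsum (r:ℂ) (by rw [Complex.norm_real, Real.norm_eq_abs, abs_of_pos hr0]; linarith)
    (by rw [Complex.norm_real, Real.norm_eq_abs, abs_of_pos hr0]; linarith)).summable.norm
  have hi1 : r⁻¹ < 1 := inv_lt_one_of_one_lt₀ hr1
  have s2 := (hFsum ((r⁻¹ : ℝ):ℂ) (by rw [Complex.norm_real, Real.norm_eq_abs, abs_of_pos (by positivity)]; linarith)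
    (by rw [Complex.norm_real, Real.norm_eq_abs, abs_of_pos (by positivity)]; linarith)).summable.norm
  have hsum : Summable fun ℓ : ℤ => ‖a ℓ‖ * r ^ ℓ.natAbs := by
    refine Summable.of_nonneg_of_le (fun ℓ => by positivity) (fun ℓ => ?_) (s1.add s2)
    rw [norm_mul, norm_mul, norm_zpow, norm_zpow, Complex.norm_real, Complex.norm_real, Real.norm_eq_abs, Real.norm_eq_abs,
      abs_of_pos hr0, abs_of_pos (inv_pos.2 hr0), ← mul_add]
    gcongr
    rcases Int.natAbs_eq ℓ with h | h
    · rw [h, Int.natAbs_natCast, zpow_natCast]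
      have : 0 ≤ r⁻¹ ^ ((ℓ.natAbs : ℕ) : ℤ) := by positivity
      linarith
    · rw [h, Int.natAbs_neg, Int.natAbs_natCast, inv_zpow', neg_neg, zpow_natCast]
      have : 0 ≤ r ^ (-(ℓ.natAbs : ℤ)) := by positivity
      linarith
  set B0 := ∑' ℓ : ℤ, ‖a ℓ‖ * r ^ ℓ.natAbs with hB0
  have hB00 : 0 ≤ B0 := tsum_nonneg fun ℓ => by positivity
  set s := Real.sqrt r with hs
  have hs2 : ∀ k : ℕ, (s ^ k)^2 = r ^ k := fun k => by rw [← pow_mul, mul_comm, pow_mul, hs, Real.sq_sqrt hr0.le]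
  refine ⟨s, B0 + 1, ?_, by linarith, ?_⟩
  · rw [hs]; exact Real.lt_sqrt_of_sq_lt (by linarith)
  intro n
  simp only [hs2]
  induction n with
  | zero =>
    intro ℓ
    have := hsum.le_tsum ℓ (fun j _ => by positivity)
    rw [iterConv]
    simp only [zero_add, pow_one]
    linarith
  | succ n ih =>
    intro ℓ
    rw [iterConv, conv]
    have h := tsum_of_norm_bounded (f := fun j : ℤ => iterConv a n (ℓ - j) * a j)
      ((hsum.hasSum.mul_left ((B0+1)^(n+1))).mul_right ((r ^ ℓ.natAbs)⁻¹)) (fun j => by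
        rw [← div_eq_mul_inv, le_div_iff₀ (by positivity), norm_mul]
        have h1 : r ^ ℓ.natAbs ≤ r ^ (ℓ - j).natAbs * r ^ j.natAbs := by
          rw [← pow_add]
          exact pow_le_pow_right₀ hr1.le (by omega)
        calc ‖iterConv a n (ℓ - j)‖ * ‖a j‖ * r ^ ℓ.natAbs ≤ ‖iterConv a n (ℓ - j)‖ * ‖a j‖ * (r ^ (ℓ - j).natAbs * r ^ j.natAbs) := by gcongr
          _ = (‖iterConv a n (ℓ - j)‖ * r ^ (ℓ - j).natAbs) * (‖a j‖ * r ^ j.natAbs) := by ring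
          _ ≤ _ := by gcongr; exact ih _)
    calc _ ≤ ((B0+1)^(n+1) * B0 * (r ^ ℓ.natAbs)⁻¹) * r ^ ℓ.natAbs := by gcongr
      _ = (B0+1)^(n+1) * B0 := by field_simp
      _ ≤ (B0+1)^(n+1) * (B0 + 1) := by gcongr; linarith
      _ = _ := by rw [← pow_succ]

lemma iter_tail' (a : ℤ → ℂ) (ε : ℝ) (hε : 0 < ε) (F : ℂ → ℂ)
    (hFsum : ∀ ζ : ℂ, 1 - ε < ‖ζ‖ → ‖ζ‖ < 1 + ε → HasSum (fun ℓ : ℤ => a ℓ * ζ ^ ℓ) (F ζ)) (Q : ℕ) :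
    ∃ L : ℕ, ∃ C : ℝ, 0 ≤ C ∧ ∀ n : ℕ, 1 ≤ n → ∀ ℓ : ℤ, (L:ℝ) * n ≤ |(ℓ:ℝ)| →
      ‖iterConv a (n-1) ℓ‖ * |(ℓ:ℝ)| ^ Q ≤ C := by
  obtain ⟨s, B, hs, hB, h⟩ := iter_tail a ε hε F hFsum
  obtain ⟨L, hL⟩ := pow_unbounded_of_one_lt B hs
  obtain ⟨C, hC0, hC⟩ := geom_bdd_poly s⁻¹ (by positivity) (inv_lt_one_of_one_lt₀ hs) Q
  have hs0 : 0 < s := by linarith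
  refine ⟨L, C, hC0, fun n hn ℓ hℓ => ?_⟩
  have habs : |(ℓ:ℝ)| = (ℓ.natAbs : ℝ) := by rw [Nat.cast_natAbs, Int.cast_abs]
  rw [habs] at hℓ ⊢
  have hℓ' : L * n ≤ ℓ.natAbs := by exact_mod_cast hℓ
  have h1 := h (n-1) ℓ
  rw [show n - 1 + 1 = n by omega] at h1
  have h2 : B ^ n ≤ s ^ ℓ.natAbs := by
    calc B ^ n ≤ (s ^ L) ^ n := by gcongr
      _ = s ^ (L * n) := by rw [← pow_mul]
      _ ≤ _ := pow_le_pow_right₀ hs.le hℓ'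
  have hp : 0 < s ^ ℓ.natAbs := by positivity
  have h3 : ‖iterConv a (n-1) ℓ‖ ≤ s⁻¹ ^ ℓ.natAbs := by
    rw [inv_pow, ← one_div, le_div_iff₀ hp]
    have h4 := h1.trans h2
    rw [sq, ← mul_assoc] at h4
    exact le_of_mul_le_mul_right (by rw [one_mul]; exact h4) hp
  calc ‖iterConv a (n-1) ℓ‖ * (ℓ.natAbs:ℝ) ^ Q ≤ s⁻¹ ^ ℓ.natAbs * (ℓ.natAbs:ℝ) ^ Q := by gcongr
    _ = (ℓ.natAbs:ℝ) ^ Q * s⁻¹ ^ ℓ.natAbs := by ring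
    _ ≤ C := hC _

lemma v_tail (μ : ℕ) (hμ : 1 ≤ μ) (β : ℂ) (hβ : 0 < β.re) (γ : ℕ → ℂ) (m : ℕ) (α : ℝ) (Q : ℕ) :
    ∃ C : ℝ, 0 ≤ C ∧ ∀ n : ℕ, 1 ≤ n → ∀ ℓ : ℤ, (2 * |α| + 1) * n ≤ |(ℓ:ℝ)| →
      (n : ℝ) ^ (-((m : ℝ) + 1) / (2 * (μ : ℝ))) *
        ‖PdiffH μ γ m (Hfun μ β) (((ℓ : ℝ) - α * n) / (n : ℝ) ^ ((1 : ℝ) / (2 * (μ : ℝ))))‖ * |(ℓ:ℝ)| ^ Q ≤ C := by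
  obtain ⟨C, hC0, hC⟩ := PdiffH_decay μ hμ β hβ γ m (2 * Q)
  refine ⟨4^Q * C, by positivity, fun n hn ℓ hℓ => ?_⟩
  have hn1 : (1:ℝ) ≤ n := by exact_mod_cast hn
  rw [rpow_scale]
  set N : ℝ := (n : ℝ) ^ ((1 : ℝ) / (2 * (μ : ℝ))) with hN
  have hN1 : 1 ≤ N := Real.one_le_rpow hn1 (by positivity)
  have hN0 : 0 < N := by linarith
  have hN2 : N ^ 2 ≤ n := by
    have h1 : N ^ (2*μ) = n := rpow_inv_pow μ hμ n
    rw [← h1]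
    exact pow_le_pow_right₀ hN1 (by omega)
  set x : ℝ := ((ℓ : ℝ) - α * n) / N with hx
  have hx2 : |(ℓ:ℝ)| / 4 ≤ |x| ^ 2 := by
    have h1 : |(ℓ:ℝ)| / 2 ≤ |(ℓ:ℝ) - α * n| := by
      have h2 := abs_sub_abs_le_abs_sub (ℓ:ℝ) (α * n)
      rw [abs_mul, Nat.abs_cast] at h2
      nlinarith
    have h3 : (n:ℝ) ≤ |(ℓ:ℝ)| := by nlinarith [abs_nonneg α]
    rw [hx, abs_div, abs_of_pos hN0, div_pow, le_div_iff₀ (by positivity)]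
    calc |(ℓ:ℝ)| / 4 * N^2 ≤ |(ℓ:ℝ)| / 4 * |(ℓ:ℝ)| := by gcongr; linarith
      _ = (|(ℓ:ℝ)| / 2)^2 := by ring
      _ ≤ _ := by gcongr
  have h5 : |(ℓ:ℝ)| ^ Q ≤ 4^Q * |x|^(2*Q) := by
    rw [pow_mul, ← mul_pow]
    gcongr
    linarith
  have h6 : (N^(m+1))⁻¹ ≤ 1 := inv_le_one_of_one_le₀ (one_le_pow₀ hN1)
  calc (N^(m+1))⁻¹ * ‖PdiffH μ γ m (Hfun μ β) x‖ * |(ℓ:ℝ)| ^ Q ≤ 1 * ‖PdiffH μ γ m (Hfun μ β) x‖ * (4^Q * |x|^(2*Q)) := by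
        gcongr
    _ = 4^Q * (|x|^(2*Q) * ‖PdiffH μ γ m (Hfun μ β) x‖) := by ring
    _ ≤ _ := by gcongr; exact hC x

lemma combine_bound (E : ℕ → ℤ → ℂ) (M μ : ℕ) (hμ : 1 ≤ μ) (L C1 C2 : ℝ) (hL : 1 ≤ L) (hC1 : 0 ≤ C1) (hC2 : 0 ≤ C2)
    (h1 : ∀ n : ℕ, 1 ≤ n → ∀ ℓ : ℤ, ‖E n ℓ‖ ≤ C1 * (n : ℝ) ^ (-(((M + 4 * μ : ℕ) : ℝ) + 1) / (2 * (μ : ℝ))))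
    (h2 : ∀ n : ℕ, 1 ≤ n → ∀ ℓ : ℤ, L * n ≤ |(ℓ:ℝ)| → ‖E n ℓ‖ * |(ℓ:ℝ)| ^ (M+3) ≤ C2) :
    ∃ C : ℝ, 0 ≤ C ∧ ∀ n : ℕ, 1 ≤ n → ∀ ℓ : ℤ, ‖E n ℓ‖ ≤ C * (n : ℝ) ^ (-((M : ℝ) + 1) / (2 * (μ : ℝ))) * (1 + (ℓ:ℝ)^2)⁻¹ := by
  refine ⟨C1 * (1 + L^2) + 2 * C2, by positivity, fun n hn ℓ => ?_⟩
  have hn1 : (1:ℝ) ≤ n := by exact_mod_cast hn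
  have hn0 : (0:ℝ) < n := by linarith
  have hμ1 : (1:ℝ) ≤ μ := by exact_mod_cast hμ
  set R := (n : ℝ) ^ (-((M : ℝ) + 1) / (2 * (μ : ℝ))) with hR
  have hR0 : 0 < R := Real.rpow_pos_of_pos hn0 _
  rw [← div_eq_mul_inv, le_div_iff₀ (by positivity)]
  by_cases h : L * n ≤ |(ℓ:ℝ)|
  · have h3 := h2 n hn ℓ h
    have hl1 : (n:ℝ) ≤ |(ℓ:ℝ)| := by nlinarith
    have hnR : ((n:ℝ)^(M+1))⁻¹ ≤ R := by
      rw [hR, ← Real.rpow_natCast, ← Real.rpow_neg (by linarith)]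
      apply Real.rpow_le_rpow_of_exponent_le hn1
      rw [neg_div, neg_le_neg_iff]
      push_cast
      apply div_le_self (by positivity) (by linarith)
    have h4 : (1 + (ℓ:ℝ)^2) ≤ 2 * (|(ℓ:ℝ)|^(M+3) * ((n:ℝ)^(M+1))⁻¹) := by
      have h5 : |(ℓ:ℝ)|^2 ≤ |(ℓ:ℝ)|^(M+3) * ((n:ℝ)^(M+1))⁻¹ := by
        rw [← div_eq_mul_inv, le_div_iff₀ (by positivity), show M + 3 = 2 + (M+1) by ring, pow_add |(ℓ:ℝ)| 2 (M+1)]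
        gcongr
      rw [sq_abs] at h5
      have h6 : 1 ≤ |(ℓ:ℝ)| := hn1.trans hl1
      have h7 : 1 ≤ (ℓ:ℝ)^2 := by rw [← sq_abs]; exact one_le_pow₀ h6
      linarith
    calc ‖E n ℓ‖ * (1 + (ℓ:ℝ)^2) ≤ ‖E n ℓ‖ * (2 * (|(ℓ:ℝ)|^(M+3) * ((n:ℝ)^(M+1))⁻¹)) := by gcongr
      _ = 2 * (‖E n ℓ‖ * |(ℓ:ℝ)|^(M+3)) * ((n:ℝ)^(M+1))⁻¹ := by ring
      _ ≤ 2 * C2 * R := by gcongr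
      _ ≤ _ := by gcongr; nlinarith [sq_nonneg L]
  · push Not at h
    have h3 := h1 n hn ℓ
    have e : (n : ℝ) ^ (-(((M + 4 * μ : ℕ) : ℝ) + 1) / (2 * (μ : ℝ))) = R * ((n:ℝ)^2)⁻¹ := by
      rw [hR, ← Real.rpow_natCast, ← Real.rpow_neg hn0.le, ← Real.rpow_add hn0]
      congr 1
      push_cast
      field_simp
      ring
    rw [e] at h3
    have h4 : (1 + (ℓ:ℝ)^2) ≤ (1 + L^2) * (n:ℝ)^2 := by
      have h5 : (ℓ:ℝ)^2 ≤ (L * n)^2 := by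
        rw [← sq_abs (ℓ:ℝ)]
        gcongr
      have : 1 ≤ (n:ℝ)^2 := one_le_pow₀ hn1
      rw [mul_pow] at h5
      linarith
    calc ‖E n ℓ‖ * (1 + (ℓ:ℝ)^2) ≤ (C1 * (R * ((n:ℝ)^2)⁻¹)) * ((1 + L^2) * (n:ℝ)^2) := by gcongr
      _ = C1 * (1 + L^2) * R := by field_simp
      _ ≤ _ := by gcongr; linarith

/-! ### Part 8 : summation -/

lemma sum_inv_le (N y : ℝ) (hN : 1 ≤ N) :
    Summable (fun ℓ : ℤ => (1 + (((ℓ:ℝ) - y) / N)^2)⁻¹) ∧ ∑' ℓ : ℤ, (1 + (((ℓ:ℝ) - y) / N)^2)⁻¹ ≤ 3 * (N * Real.pi) := by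
  have hN0 : 0 < N := by linarith
  set φ : ℝ → ℝ := fun t => (1 + ((t - y) / N)^2)⁻¹ with hφ
  have hφi : MeasureTheory.Integrable φ := by
    have h := (integrable_inv_one_add_sq.comp_div hN0.ne').comp_sub_right y
    exact h
  have hφv : ∫ t, φ t = N * Real.pi := by
    have h1 : ∫ t, φ t = ∫ t, (fun u => (1 + (u / N)^2)⁻¹) (t - y) := rfl
    rw [h1, MeasureTheory.integral_sub_right_eq_self (fun u : ℝ => (1 + (u / N)^2)⁻¹) y]
    have h2 := MeasureTheory.Measure.integral_comp_div (fun u : ℝ => (1 + u^2)⁻¹) N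
    rw [h2, integral_univ_inv_one_add_sq, abs_of_pos hN0, smul_eq_mul]
  have hs := (hφi.hasSum_intervalIntegral 0).mul_left 3
  rw [hφv] at hs
  have hφc : Continuous φ := by
    rw [hφ]
    exact Continuous.inv₀ (by fun_prop) fun t => by positivity
  have hle : ∀ ℓ : ℤ, (1 + (((ℓ:ℝ) - y) / N)^2)⁻¹ ≤ 3 * ∫ x in (0 + (ℓ:ℝ))..(0 + ℓ + 1), φ x := by
    intro ℓ
    have h1 : ∫ x in (0 + (ℓ:ℝ))..(0 + ℓ + 1), (1/3 * (1 + (((ℓ:ℝ) - y) / N)^2)⁻¹) ≤ ∫ x in (0 + (ℓ:ℝ))..(0 + ℓ + 1), φ x := by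
      refine intervalIntegral.integral_mono_on (by linarith) (by simp) (hφc.intervalIntegrable _ _) fun t ht => ?_
      simp only [hφ]
      rw [← one_div, ← one_div, div_mul_div_comm, one_mul]
      apply one_div_le_one_div_of_le (by positivity)
      have ht1 : 0 ≤ t - ℓ := by linarith [ht.1]
      have ht2 : t - ℓ ≤ 1 := by linarith [ht.2]
      have e : (t - y) / N = ((ℓ:ℝ) - y)/N + (t - ℓ)/N := by ring
      have hb : ((t - ℓ)/N)^2 ≤ 1 := by
        apply pow_le_one₀ (by positivity)
        rw [div_le_one hN0]; linarith
      rw [e]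
      nlinarith [sq_nonneg (((ℓ:ℝ) - y)/N - (t - ℓ)/N)]
    rw [intervalIntegral.integral_const] at h1
    simp only [smul_eq_mul] at h1
    have : (0 + (ℓ:ℝ) + 1 - (0 + ℓ)) = 1 := by ring
    rw [this, one_mul] at h1
    linarith
  have hsm : Summable (fun ℓ : ℤ => (1 + (((ℓ:ℝ) - y) / N)^2)⁻¹) :=
    Summable.of_nonneg_of_le (fun ℓ => by positivity) hle hs.summable
  exact ⟨hsm, (hsm.tsum_le_tsum hle hs.summable).trans (le_of_eq hs.tsum_eq)⟩

lemma v_l1 (μ : ℕ) (hμ : 1 ≤ μ) (β : ℂ) (hβ : 0 < β.re) (γ : ℕ → ℂ) (m : ℕ) (α : ℝ) :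
    ∃ C : ℝ, 0 ≤ C ∧ ∀ n : ℕ, 1 ≤ n →
      (Summable fun ℓ : ℤ => (n : ℝ) ^ (-((m : ℝ) + 1) / (2 * (μ : ℝ))) *
        ‖PdiffH μ γ m (Hfun μ β) (((ℓ : ℝ) - α * n) / (n : ℝ) ^ ((1 : ℝ) / (2 * (μ : ℝ))))‖) ∧
      ∑' ℓ : ℤ, (n : ℝ) ^ (-((m : ℝ) + 1) / (2 * (μ : ℝ))) *
        ‖PdiffH μ γ m (Hfun μ β) (((ℓ : ℝ) - α * n) / (n : ℝ) ^ ((1 : ℝ) / (2 * (μ : ℝ))))‖ ≤ C * (n : ℝ) ^ (-(m : ℝ) / (2 * (μ : ℝ))) := by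
  obtain ⟨C0, hC00, hC0⟩ := PdiffH_decay μ hμ β hβ γ m 0
  obtain ⟨C2, hC20, hC2⟩ := PdiffH_decay μ hμ β hβ γ m 2
  refine ⟨(C0 + C2) * (3 * Real.pi), by positivity, fun n hn => ?_⟩
  have hn1 : (1:ℝ) ≤ n := by exact_mod_cast hn
  have hn0 : (0:ℝ) < n := by linarith
  have hμ1 : (1:ℝ) ≤ μ := by exact_mod_cast hμ
  have e : (n : ℝ) ^ (-(m : ℝ) / (2 * (μ : ℝ))) = (n : ℝ) ^ (-((m : ℝ) + 1) / (2 * (μ : ℝ))) * (n : ℝ) ^ ((1 : ℝ) / (2 * (μ : ℝ))) := by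
    rw [← Real.rpow_add hn0]; congr 1; ring
  rw [e]
  set N : ℝ := (n : ℝ) ^ ((1 : ℝ) / (2 * (μ : ℝ))) with hN
  have hN1 : 1 ≤ N := Real.one_le_rpow hn1 (by positivity)
  set P : ℝ := (n : ℝ) ^ (-((m : ℝ) + 1) / (2 * (μ : ℝ))) with hP
  have hP0 : 0 < P := Real.rpow_pos_of_pos hn0 _
  obtain ⟨hs, hle⟩ := sum_inv_le N (α * n) hN1
  have hb : ∀ ℓ : ℤ, P * ‖PdiffH μ γ m (Hfun μ β) (((ℓ : ℝ) - α * n) / N)‖ ≤ P * (C0 + C2) * (1 + (((ℓ:ℝ) - α * n) / N)^2)⁻¹ := by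
    intro ℓ
    set x := ((ℓ : ℝ) - α * n) / N with hx
    have h1 := hC0 x
    have h2 := hC2 x
    rw [pow_zero, one_mul] at h1
    rw [sq_abs] at h2
    rw [mul_assoc]
    gcongr
    rw [← div_eq_mul_inv, le_div_iff₀ (by positivity)]
    linarith
  have hs2 := hs.mul_left (P * (C0 + C2))
  have hsm := Summable.of_nonneg_of_le (fun ℓ => by positivity) hb hs2
  refine ⟨hsm, (hsm.tsum_le_tsum hb hs2).trans ?_⟩
  rw [tsum_mul_left]
  calc _ ≤ P * (C0 + C2) * (3 * (N * Real.pi)) := by gcongr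
    _ = _ := by ring


/-! ### Part 9 : Young's inequality and conclusion -/

lemma shift_mem (p : ENNReal) (hp : 1 ≤ p) (u : lp (fun _ : ℤ => ℂ) p) (j : ℤ) :
    ∃ h : Memℓp (fun ℓ : ℤ => (u (ℓ - j) : ℂ)) p,
      ‖(⟨fun ℓ : ℤ => (u (ℓ - j) : ℂ), h⟩ : lp (fun _ : ℤ => ℂ) p)‖ = ‖u‖ := by
  have hu := lp.memℓp u
  rcases eq_or_ne p ⊤ with rfl | hpt
  · have h : Memℓp (fun ℓ : ℤ => (u (ℓ - j) : ℂ)) ⊤ := by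
      rw [memℓp_infty_iff] at hu ⊢
      refine hu.mono ?_
      rintro _ ⟨ℓ, rfl⟩
      exact ⟨ℓ - j, rfl⟩
    refine ⟨h, ?_⟩
    rw [lp.norm_eq_ciSup, lp.norm_eq_ciSup]
    exact (Equiv.subRight j).iSup_comp (g := fun ℓ : ℤ => ‖(u ℓ : ℂ)‖)
  · have hp0 : 0 < p.toReal := ENNReal.toReal_pos (by intro h; rw [h] at hp; simp at hp) hpt
    have h : Memℓp (fun ℓ : ℤ => (u (ℓ - j) : ℂ)) p := by
      rw [memℓp_gen_iff hp0] at hu ⊢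
      exact (Equiv.subRight j).summable_iff.2 hu
    refine ⟨h, ?_⟩
    rw [lp.norm_eq_tsum_rpow hp0, lp.norm_eq_tsum_rpow hp0]
    congr 1
    exact (Equiv.subRight j).tsum_eq (fun ℓ : ℤ => ‖(u ℓ : ℂ)‖ ^ p.toReal)

lemma conv_summable (b : ℤ → ℂ) (hb : Summable fun ℓ => ‖b ℓ‖) (p : ENNReal) (hp : 1 ≤ p) (u : lp (fun _ : ℤ => ℂ) p) (ℓ : ℤ) :
    Summable fun j : ℤ => b (ℓ - j) * u j := by
  have h1 : Summable fun j : ℤ => ‖b (ℓ - j)‖ * ‖u‖ :=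
    ((Equiv.subLeft ℓ).summable_iff.2 hb).mul_right _
  refine Summable.of_norm_bounded h1 fun j => ?_
  rw [norm_mul]
  gcongr
  exact lp.norm_apply_le_norm (by intro h; rw [h] at hp; simp at hp) u j

lemma young (b : ℤ → ℂ) (hb : Summable fun ℓ => ‖b ℓ‖) (p : ENNReal) (hp : 1 ≤ p) (u : lp (fun _ : ℤ => ℂ) p) :
    ∃ h : Memℓp (fun ℓ : ℤ => conv b (fun i => u i) ℓ) p,
      ‖(⟨fun ℓ : ℤ => conv b (fun i => u i) ℓ, h⟩ : lp (fun _ : ℤ => ℂ) p)‖ ≤ (∑' ℓ, ‖b ℓ‖) * ‖u‖ := by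
  have : Fact (1 ≤ p) := ⟨hp⟩
  choose hm hn using shift_mem p hp u
  set T : ℤ → lp (fun _ : ℤ => ℂ) p := fun j => b j • ⟨fun ℓ : ℤ => (u (ℓ - j) : ℂ), hm j⟩ with hT
  have hTn : ∀ j, ‖T j‖ = ‖b j‖ * ‖u‖ := fun j => by
    simp only [hT]
    rw [norm_smul, hn]
  have hs : HasSum (fun j => ‖b j‖ * ‖u‖) ((∑' ℓ, ‖b ℓ‖) * ‖u‖) := hb.hasSum.mul_right _
  have hTs : Summable T := Summable.of_norm_bounded hs.summable fun j => (hTn j).le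
  have hle : ‖∑' j, T j‖ ≤ (∑' ℓ, ‖b ℓ‖) * ‖u‖ := tsum_of_norm_bounded hs fun j => (hTn j).le
  have heq : ((∑' j, T j : lp (fun _ : ℤ => ℂ) p) : ℤ → ℂ) = fun ℓ : ℤ => conv b (fun i => u i) ℓ := by
    funext ℓ
    have h1 := hTs.hasSum.map (lp.evalCLM ℂ (fun _ : ℤ => ℂ) p ℓ) (lp.evalCLM ℂ (fun _ : ℤ => ℂ) p ℓ).continuous
    have h2 : HasSum (fun j : ℤ => b j * u (ℓ - j)) ((∑' j, T j : lp (fun _ : ℤ => ℂ) p) ℓ) := h1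
    rw [conv, ← h2.tsum_eq, ← (Equiv.subLeft ℓ).tsum_eq]
    refine tsum_congr fun j => ?_
    simp [Equiv.subLeft_apply]
  have hmem : Memℓp (fun ℓ : ℤ => conv b (fun i => u i) ℓ) p := heq ▸ lp.memℓp (∑' j, T j)
  refine ⟨hmem, ?_⟩
  have : (⟨fun ℓ : ℤ => conv b (fun i => u i) ℓ, hmem⟩ : lp (fun _ : ℤ => ℂ) p) = ∑' j, T j := by
    apply Subtype.ext
    exact heq.symm
  rw [this]
  exact hle


/-- Large time asymptotics in `ℓ^p`, `1 ≤ p ≤ ∞`, for `a^{⋆n} ⋆ u⁰`. -/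
theorem lp_asymptotics
    (a : ℤ → ℂ) (ha : Summable fun ℓ : ℤ => ‖a ℓ‖)
    (ε : ℝ) (hε : 0 < ε) (F : ℂ → ℂ)
    (hFsum : ∀ ζ : ℂ, 1 - ε < ‖ζ‖ → ‖ζ‖ < 1 + ε →
      HasSum (fun ℓ : ℤ => a ℓ * ζ ^ ℓ) (F ζ))
    (hFhol : DifferentiableOn ℂ F {ζ : ℂ | 1 - ε < ‖ζ‖ ∧ ‖ζ‖ < 1 + ε})
    (hFsup : IsLUB {y : ℝ | ∃ κ : ℂ, ‖κ‖ = 1 ∧ y = ‖F κ‖} 1)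
    (K : ℕ) (hK : 1 ≤ K) (κ : Fin K → ℂ) (hκinj : Function.Injective κ)
    (hκmod : ∀ k, ‖κ k‖ = 1)
    (hκtang : ∀ k, ‖F (κ k)‖ = 1)
    (hlt : ∀ z : ℂ, ‖z‖ = 1 → (∀ k, z ≠ κ k) → ‖F z‖ < 1)
    (α : Fin K → ℝ) (β : Fin K → ℂ) (hβ : ∀ k, 0 < (β k).re)
    (μ : Fin K → ℕ) (hμ : ∀ k, 1 ≤ μ k)
    (γ : Fin K → ℕ → ℂ) (hγlow : ∀ k, ∀ ν : ℕ, ν < 2 * μ k + 1 → γ k ν = 0)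
    (hexp : ∀ k, ∃ ρ : ℝ, 0 < ρ ∧ ∀ ξ : ℂ, ‖ξ‖ < ρ → ∃ s : ℂ,
      HasSum (fun ν : ℕ => γ k ν * (Complex.I * ξ) ^ ν / (Nat.factorial ν : ℂ)) s ∧
      F (κ k * Complex.exp (Complex.I * ξ)) =
        F (κ k) * Complex.exp (Complex.I * (α k) * ξ - β k * ξ ^ (2 * μ k) + s))
    (v : ℕ → Fin K → ℕ → ℤ → ℂ)
    (hv : ∀ n k m, v n k m = fun ℓ : ℤ =>
      κ k ^ (-ℓ) * F (κ k) ^ n *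
        (((n : ℝ) ^ (-((m : ℝ) + 1) / (2 * (μ k : ℝ))) : ℝ) : ℂ) *
        PdiffH (μ k) (γ k) m (Hfun (μ k) (β k))
          (((ℓ : ℝ) - α k * n) / (n : ℝ) ^ ((1 : ℝ) / (2 * (μ k : ℝ))))) :
    ∀ M : ℕ, ∃ C : ℝ, 0 < C ∧
      ∀ p : ENNReal, 1 ≤ p → ∀ u : lp (fun _ : ℤ => ℂ) p, ∀ n : ℕ, 1 ≤ n →
        ∀ g : ℤ → ℂ,
          (g = fun ℓ : ℤ => conv (iterConv a (n - 1)) (fun i => u i) ℓ -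
            ∑ k : Fin K, ∑ m ∈ Finset.range (M + 1), conv (v n k m) (fun i => u i) ℓ) →
          ∃ hg : Memℓp g p,
            ‖(⟨g, hg⟩ : lp (fun _ : ℤ => ℂ) p)‖ ≤
              C * ‖u‖ * (n : ℝ) ^ (-((M : ℝ) + 1) / (2 * ((Finset.univ.sup μ : ℕ) : ℝ))) := by
  intro M
  set μm := Finset.univ.sup μ with hμm
  have hμle : ∀ k, μ k ≤ μm := fun k => Finset.le_sup (Finset.mem_univ k)
  have hμm1 : 1 ≤ μm := (hμ ⟨0, hK⟩).trans (hμle _)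
  set M' := M + 4 * μm with hM'
  obtain ⟨C1, hC10, hC1⟩ := sup_bound a ha ε hε F hFsum K κ hκinj hκmod hκtang hlt α β hβ μ hμ hK γ hγlow hexp v hv M'
  obtain ⟨L, CL, hCL0, hCL⟩ := iter_tail' a ε hε F hFsum (M+3)
  choose Ct hCt0 hCt using fun (k : Fin K) (m : ℕ) => v_tail (μ k) (hμ k) (β k) (hβ k) (γ k) m (α k) (M+3)
  choose Cs hCs0 hCs using fun (k : Fin K) (m : ℕ) => v_l1 (μ k) (hμ k) (β k) (hβ k) (γ k) m (α k)
  have hvn : ∀ n k m ℓ, ‖v n k m ℓ‖ = (n : ℝ) ^ (-((m : ℝ) + 1) / (2 * (μ k : ℝ))) *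
        ‖PdiffH (μ k) (γ k) m (Hfun (μ k) (β k)) (((ℓ : ℝ) - α k * n) / (n : ℝ) ^ ((1 : ℝ) / (2 * (μ k : ℝ))))‖ := by
    intro n k m ℓ
    have hnn : (0:ℝ) ≤ (n : ℝ) ^ (-((m : ℝ) + 1) / (2 * (μ k : ℝ))) := by positivity
    rw [hv]
    simp only
    rw [norm_mul, norm_mul, norm_mul, norm_zpow, norm_pow, hκmod, hκtang, one_zpow, one_pow, one_mul, one_mul,
      Complex.norm_real, Real.norm_eq_abs, abs_of_nonneg hnn]
  set E : ℕ → ℤ → ℂ := fun n ℓ => iterConv a (n-1) ℓ - ∑ k : Fin K, ∑ m ∈ Finset.range (M'+1), v n k m ℓ with hE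
  set L' : ℝ := L + 1 + ∑ k, (2 * |α k| + 1) with hL'
  have hsumnn : 0 ≤ ∑ k, (2 * |α k| + 1) := Finset.sum_nonneg fun k _ => by positivity
  have hL0 : (0:ℝ) ≤ L := Nat.cast_nonneg L
  obtain ⟨C3, hC30, hC3⟩ := combine_bound E M μm hμm1 L' C1 (CL + ∑ k, ∑ m ∈ Finset.range (M'+1), Ct k m)
    (by rw [hL']; linarith) hC10 (add_nonneg hCL0 (Finset.sum_nonneg fun k _ => Finset.sum_nonneg fun m _ => hCt0 k m))
    (fun n hn ℓ => hC1 n hn ℓ) (fun n hn ℓ hℓ => by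
      have hn0 : (0:ℝ) ≤ n := Nat.cast_nonneg n
      have t1 : ‖E n ℓ‖ ≤ ‖iterConv a (n-1) ℓ‖ + ∑ k : Fin K, ∑ m ∈ Finset.range (M'+1), ‖v n k m ℓ‖ := by
        refine (norm_sub_le _ _).trans ?_
        gcongr
        refine (norm_sum_le _ _).trans (Finset.sum_le_sum fun k _ => norm_sum_le _ _)
      have t2 : ‖iterConv a (n-1) ℓ‖ * |(ℓ:ℝ)| ^ (M+3) ≤ CL :=
        hCL n hn ℓ (le_trans (by rw [hL']; gcongr; linarith) hℓ)
      have t3 : ∀ k, ∀ m, ‖v n k m ℓ‖ * |(ℓ:ℝ)| ^ (M+3) ≤ Ct k m := by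
        intro k m
        rw [hvn]
        refine hCt k m n hn ℓ (le_trans ?_ hℓ)
        have : 2 * |α k| + 1 ≤ ∑ k, (2 * |α k| + 1) :=
          Finset.single_le_sum (f := fun k => 2 * |α k| + 1) (fun k _ => by positivity) (Finset.mem_univ k)
        exact mul_le_mul_of_nonneg_right (by rw [hL']; linarith) (Nat.cast_nonneg n)
      calc ‖E n ℓ‖ * |(ℓ:ℝ)| ^ (M+3) ≤ (‖iterConv a (n-1) ℓ‖ + ∑ k : Fin K, ∑ m ∈ Finset.range (M'+1), ‖v n k m ℓ‖) * |(ℓ:ℝ)| ^ (M+3) := by gcongr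
        _ = ‖iterConv a (n-1) ℓ‖ * |(ℓ:ℝ)| ^ (M+3) + ∑ k : Fin K, ∑ m ∈ Finset.range (M'+1), ‖v n k m ℓ‖ * |(ℓ:ℝ)| ^ (M+3) := by
            rw [add_mul, Finset.sum_mul]; simp only [Finset.sum_mul]
        _ ≤ _ := add_le_add t2 (Finset.sum_le_sum fun k _ => Finset.sum_le_sum fun m _ => t3 k m))
  obtain ⟨hw, hwle⟩ := sum_inv_le 1 0 le_rfl
  simp only [sub_zero, div_one] at hw hwle
  set C4 : ℝ := ∑ k, ∑ m ∈ Finset.Ico (M+1) (M'+1), Cs k m with hC4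
  have hC40 : 0 ≤ C4 := Finset.sum_nonneg fun k _ => Finset.sum_nonneg fun m _ => hCs0 k m
  refine ⟨C3 * (3 * (1 * Real.pi)) + C4 + 1, by positivity, ?_⟩
  intro p hp u n hn g hg
  have hn1 : (1:ℝ) ≤ n := by exact_mod_cast hn
  set R := (n : ℝ) ^ (-((M : ℝ) + 1) / (2 * (μm : ℝ))) with hR
  have hR0 : 0 < R := Real.rpow_pos_of_pos (by linarith) _
  have hvs : ∀ k m, Summable fun ℓ : ℤ => ‖v n k m ℓ‖ := by
    intro k m
    simp only [hvn]
    exact (hCs k m n hn).1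
  have hvt : ∀ k, ∀ m ∈ Finset.Ico (M+1) (M'+1), ∑' ℓ : ℤ, ‖v n k m ℓ‖ ≤ Cs k m * R := by
    intro k m hm
    simp only [hvn]
    refine (hCs k m n hn).2.trans ?_
    have h1 : (n : ℝ) ^ (-(m : ℝ) / (2 * (μ k : ℝ))) ≤ (n : ℝ) ^ (-((M:ℝ) + 1) / (2 * (μ k : ℝ))) := by
      apply Real.rpow_le_rpow_of_exponent_le hn1
      have : (M:ℝ) + 1 ≤ m := by exact_mod_cast (Finset.mem_Ico.1 hm).1
      gcongr
    have h2 := rpow_neg_mono n hn ((M:ℝ)+1) (by positivity) (μ k) μm (hμ k) (hμle k)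
    have := hCs0 k m
    have h3 := h1.trans h2
    gcongr
  set e : ℤ → ℂ := fun ℓ => iterConv a (n-1) ℓ - ∑ k : Fin K, ∑ m ∈ Finset.range (M+1), v n k m ℓ with he
  have hesplit : ∀ ℓ, e ℓ = E n ℓ + ∑ k : Fin K, ∑ m ∈ Finset.Ico (M+1) (M'+1), v n k m ℓ := by
    intro ℓ
    simp only [he, hE]
    have : ∀ k, ∑ m ∈ Finset.range (M'+1), v n k m ℓ = ∑ m ∈ Finset.range (M+1), v n k m ℓ + ∑ m ∈ Finset.Ico (M+1) (M'+1), v n k m ℓ :=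
      fun k => (Finset.sum_range_add_sum_Ico _ (by omega)).symm
    simp only [this, Finset.sum_add_distrib]
    ring
  have hdom : ∀ ℓ : ℤ, ‖e ℓ‖ ≤ C3 * R * (1 + (ℓ:ℝ)^2)⁻¹ + ∑ k : Fin K, ∑ m ∈ Finset.Ico (M+1) (M'+1), ‖v n k m ℓ‖ := by
    intro ℓ
    rw [hesplit]
    refine (norm_add_le _ _).trans (add_le_add (hC3 n hn ℓ) ?_)
    exact (norm_sum_le _ _).trans (Finset.sum_le_sum fun k _ => norm_sum_le _ _)
  have hS1 := hw.mul_left (C3 * R)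
  have hS2 : Summable fun ℓ : ℤ => ∑ k : Fin K, ∑ m ∈ Finset.Ico (M+1) (M'+1), ‖v n k m ℓ‖ :=
    summable_sum fun k _ => summable_sum fun m _ => hvs k m
  have hes : Summable fun ℓ => ‖e ℓ‖ := Summable.of_nonneg_of_le (fun ℓ => norm_nonneg _) hdom (hS1.add hS2)
  have het : ∑' ℓ, ‖e ℓ‖ ≤ (C3 * (3 * (1 * Real.pi)) + C4) * R := by
    refine (hes.tsum_le_tsum hdom (hS1.add hS2)).trans ?_
    rw [hS1.tsum_add hS2, tsum_mul_left, Summable.tsum_finsetSum fun k _ => summable_sum fun m _ => hvs k m, add_mul]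
    refine add_le_add ?_ ?_
    · calc C3 * R * _ ≤ C3 * R * (3 * (1 * Real.pi)) := by gcongr
        _ = _ := by ring
    · rw [hC4, Finset.sum_mul]
      refine Finset.sum_le_sum fun k _ => ?_
      rw [Summable.tsum_finsetSum fun m _ => hvs k m, Finset.sum_mul]
      exact Finset.sum_le_sum fun m hm => hvt k m hm
  have his : Summable fun ℓ => ‖iterConv a (n-1) ℓ‖ := by
    have h1 : Summable fun ℓ : ℤ => ∑ k : Fin K, ∑ m ∈ Finset.range (M+1), ‖v n k m ℓ‖ :=
      summable_sum fun k _ => summable_sum fun m _ => hvs k m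
    refine Summable.of_nonneg_of_le (fun ℓ => norm_nonneg _) (fun ℓ => ?_) (hes.add h1)
    have : iterConv a (n-1) ℓ = e ℓ + ∑ k : Fin K, ∑ m ∈ Finset.range (M+1), v n k m ℓ := by simp only [he]; ring
    rw [this]
    refine (norm_add_le _ _).trans (add_le_add le_rfl ?_)
    exact (norm_sum_le _ _).trans (Finset.sum_le_sum fun k _ => norm_sum_le _ _)
  have hge : g = fun ℓ : ℤ => conv e (fun i => u i) ℓ := by
    rw [hg]
    funext ℓ
    have hcv := fun k m => conv_summable (v n k m) (hvs k m) p hp u ℓ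
    have hci := conv_summable (iterConv a (n-1)) his p hp u ℓ
    simp only [conv, he, sub_mul, Finset.sum_mul]
    rw [hci.tsum_sub (summable_sum fun k _ => summable_sum fun m _ => hcv k m),
      Summable.tsum_finsetSum fun k _ => summable_sum fun m _ => hcv k m]
    congr 1
    refine Finset.sum_congr rfl fun k _ => ?_
    rw [Summable.tsum_finsetSum fun m _ => hcv k m]
  subst hge
  obtain ⟨hmem, hle⟩ := young e hes p hp u
  refine ⟨hmem, hle.trans ?_⟩
  have hu0 : 0 ≤ ‖u‖ := lp.norm_nonneg' u
  calc (∑' ℓ, ‖e ℓ‖) * ‖u‖ ≤ ((C3 * (3 * (1 * Real.pi)) + C4) * R) * ‖u‖ := by gcongr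
    _ ≤ ((C3 * (3 * (1 * Real.pi)) + C4 + 1) * R) * ‖u‖ :=
        mul_le_mul_of_nonneg_right (mul_le_mul_of_nonneg_right (by linarith) hR0.le) hu0
    _ = _ := by ring
end

section
/- Let μ ∈ ℕ*, let δ₀ > 0, let r be a holomorphic function on the open disk B(0,δ₀) ⊂ ℂ with r(0) = 0, and let β_* > 0 and β^* > 0. Define g : ℂ × B(0,δ₀) → ℂ by g(w,z) = exp(w^{2μ} r(z)). Then for every M ∈ ℕ there exist a constant C > 0 and a radius δ ∈ (0,δ₀) such that for every w ∈ ℂ and every z ∈ ℂ with max(|Re z|, |Im z|) ≤ δ, | g(w,z) − Σ_{m=0}^{M} (∂^m g/∂z^m)(w,0) · z^m/m! | ≤ C |z|^{M+1} exp( (β_*/2)(Re w)^{2μ} + β^* (Im w)^{2μ} ). -/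
open Complex

lemma aux_taylor (f : ℂ → ℂ) (R E : ℝ) (hR : 0 < R)
    (hf : DifferentiableOn ℂ f (Metric.ball (0 : ℂ) (2 * R)))
    (hE : ∀ z ∈ Metric.ball (0 : ℂ) (2 * R), ‖f z‖ ≤ E) (M : ℕ) (z : ℂ) (hz : ‖z‖ ≤ R / 2) :
    ‖f z - ∑ m ∈ Finset.range (M + 1), iteratedDeriv m f 0 * z ^ m / (Nat.factorial m : ℂ)‖ ≤
      2 / R ^ (M + 1) * ‖z‖ ^ (M + 1) * E := by
  have hE0 : 0 ≤ E := (norm_nonneg _).trans (hE 0 (by simp [hR]))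
  have hsum := Complex.hasSum_taylorSeries_on_ball (r := 2 * R) (c := 0)
    (z := z) (f := f) hf (by rw [mem_ball_zero_iff]; linarith)
  have hc : ∀ n : ℕ, ‖iteratedDeriv n f 0‖ ≤ n.factorial * E / R ^ n := by
    intro n
    refine Complex.norm_iteratedDeriv_le_of_forall_mem_sphere_norm_le n hR ?_ ?_
    · refine (hf.mono ?_).diffContOnCl
      refine Metric.closure_ball_subset_closedBall.trans ?_
      exact Metric.closedBall_subset_ball (by linarith)
    · intro y hy
      apply hE
      rw [mem_sphere_zero_iff_norm] at hy
      rw [mem_ball_zero_iff]; linarith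
  have hsum' : HasSum (fun n : ℕ => iteratedDeriv n f 0 * z ^ n / (Nat.factorial n : ℂ)) (f z) := by
    have he : (fun n : ℕ => iteratedDeriv n f 0 * z ^ n / (Nat.factorial n : ℂ)) =
        fun n : ℕ => (n.factorial : ℂ)⁻¹ • (z - 0) ^ n • iteratedDeriv n f 0 := by
      funext n
      simp only [sub_zero, smul_eq_mul]
      ring
    rw [he]
    exact hsum
  rw [← hasSum_nat_add_iff' (M + 1)] at hsum'
  have hgeo : HasSum (fun n : ℕ => E * (‖z‖ / R) ^ (M + 1) * (1 / 2 : ℝ) ^ n)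
      (E * (‖z‖ / R) ^ (M + 1) * 2) := by
    exact hasSum_geometric_two.mul_left _
  have := hsum'.norm_le_of_bounded hgeo (by
    intro n
    have h1 := hc (n + (M + 1))
    rw [norm_div, norm_mul, norm_pow, Complex.norm_natCast]
    have hfac : (0 : ℝ) < (n + (M + 1)).factorial := by exact_mod_cast Nat.factorial_pos _
    have hq : ‖z‖ / R ≤ 1 / 2 := by rw [div_le_iff₀ hR]; linarith
    calc _ ≤ ((n + (M + 1)).factorial * E / R ^ (n + (M + 1))) * ‖z‖ ^ (n + (M + 1))
            / (n + (M + 1)).factorial := by gcongr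
      _ = E * (‖z‖ / R) ^ (M + 1) * (‖z‖ / R) ^ n := by
          rw [div_pow, div_pow, pow_add, pow_add]; field_simp; ring
      _ ≤ _ := by gcongr)
  refine this.trans (le_of_eq ?_)
  rw [div_pow]; ring

lemma aux_w (μ : ℕ) (w : ℂ) : ‖w‖ ^ (2 * μ) ≤ 2 ^ μ * (w.re ^ (2 * μ) + w.im ^ (2 * μ)) := by
  rw [pow_mul, pow_mul, pow_mul, Complex.sq_norm, Complex.normSq_apply]
  have key : ∀ a b : ℝ, 0 ≤ a → 0 ≤ b → (a + b) ^ μ ≤ 2 ^ μ * (a ^ μ + b ^ μ) := by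
    intro a b ha hb
    rcases le_total a b with h | h
    · calc (a + b) ^ μ ≤ (2 * b) ^ μ := by gcongr; linarith
        _ = 2 ^ μ * b ^ μ := mul_pow _ _ _
        _ ≤ _ := by gcongr; have := pow_nonneg ha μ; linarith
    · calc (a + b) ^ μ ≤ (2 * a) ^ μ := by gcongr; linarith
        _ = 2 ^ μ * a ^ μ := mul_pow _ _ _
        _ ≤ _ := by gcongr; have := pow_nonneg hb μ; linarith
  have := key (w.re ^ 2) (w.im ^ 2) (by positivity) (by positivity)
  simpa [sq] using this

/-- Taylor remainder bound, with respect to the second variable, for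
`g (w, z) = exp (w^{2μ} r z)`, where `r` is holomorphic near `0` with `r 0 = 0`. -/
theorem taylor_remainder_bound_exp
    (μ : ℕ) (hμ : 1 ≤ μ) (δ₀ : ℝ) (hδ₀ : 0 < δ₀)
    (r : ℂ → ℂ) (hr : DifferentiableOn ℂ r (Metric.ball (0 : ℂ) δ₀)) (hr0 : r 0 = 0)
    (βs βS : ℝ) (hβs : 0 < βs) (hβS : 0 < βS)
    (g : ℂ → ℂ → ℂ) (hg : g = fun w z => Complex.exp (w ^ (2 * μ) * r z)) :
    ∀ M : ℕ, ∃ C : ℝ, 0 < C ∧ ∃ δ : ℝ, 0 < δ ∧ δ < δ₀ ∧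
      ∀ w z : ℂ, max |z.re| |z.im| ≤ δ →
        ‖g w z -
            ∑ m ∈ Finset.range (M + 1),
              iteratedDeriv m (g w) 0 * z ^ m / (Nat.factorial m : ℂ)‖ ≤
          C * ‖z‖ ^ (M + 1) *
            Real.exp (βs / 2 * w.re ^ (2 * μ) + βS * w.im ^ (2 * μ)) := by
  subst hg
  intro M
  obtain ⟨ε, hε, h1, h2⟩ : ∃ ε : ℝ, 0 < ε ∧ ε * 2 ^ μ ≤ βs / 2 ∧ ε * 2 ^ μ ≤ βS := by
    refine ⟨min (βs / 2) βS / 2 ^ μ, by positivity, ?_, ?_⟩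
    · rw [div_mul_cancel₀ _ (by positivity)]; exact min_le_left _ _
    · rw [div_mul_cancel₀ _ (by positivity)]; exact min_le_right _ _
  have hcont : ContinuousAt r 0 :=
    (hr.differentiableAt (Metric.ball_mem_nhds _ hδ₀)).continuousAt
  obtain ⟨ρ, hρ, hρr⟩ := Metric.continuousAt_iff.1 hcont ε hε
  obtain ⟨R, hR, hR1, hR2⟩ : ∃ R : ℝ, 0 < R ∧ 2 * R ≤ ρ ∧ 2 * R ≤ δ₀ := by
    refine ⟨min ρ δ₀ / 2, by positivity, ?_, ?_⟩
    · linarith [min_le_left ρ δ₀]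
    · linarith [min_le_right ρ δ₀]
  refine ⟨2 / R ^ (M + 1), by positivity, R / 4, by positivity, by linarith, ?_⟩
  intro w z hz
  have hz1 := (le_max_left _ _).trans hz
  have hz2 := (le_max_right _ _).trans hz
  have hzn : ‖z‖ ≤ R / 2 := by linarith [Complex.norm_le_abs_re_add_abs_im z]
  refine aux_taylor (fun z => Complex.exp (w ^ (2 * μ) * r z)) R _ hR ?_ ?_ M z hzn
  · exact ((hr.mono (Metric.ball_subset_ball hR2)).const_mul _).cexp
  · intro y hy
    have hy' : ‖r y‖ ≤ ε := by
      have := hρr (x := y) (lt_of_lt_of_le hy hR1)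
      rw [hr0, dist_zero_right] at this
      exact this.le
    refine (Complex.norm_exp_le_exp_norm _).trans (Real.exp_le_exp.2 ?_)
    rw [norm_mul, norm_pow]
    have hx : 0 ≤ w.re ^ (2 * μ) := (even_two_mul μ).pow_nonneg _
    have hi : 0 ≤ w.im ^ (2 * μ) := (even_two_mul μ).pow_nonneg _
    calc ‖w‖ ^ (2 * μ) * ‖r y‖ ≤ (2 ^ μ * (w.re ^ (2 * μ) + w.im ^ (2 * μ))) * ε := by
          gcongr; exact aux_w μ w
      _ = (ε * 2 ^ μ) * w.re ^ (2 * μ) + (ε * 2 ^ μ) * w.im ^ (2 * μ) := by ring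
      _ ≤ _ := by gcongr
end
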